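/- Let r, s > 0. There exists a family of constants ε_τ > 0 (indexed by τ ∈ (0,1)) such that for every τ₀ ∈ (0,1): 𝒰_{r,s} = ⋃_{τ₀ < τ < 1} (𝒱_{τr,τs,ε_τ})^{lc,Λ_g} = ⋃_{τ₀ < τ < 1} ({V ∈ ℳ : dist(V, K_{τr,τs}) < ε_τ})^{lc,Λ_g} = ⋃_{τ₀ < τ < 1} K_{τr,τs}^{lc,Λ}. -/

import Mathlib

noncomputable section

/-- Vectors in ℝ³. -/
abbrev V3 : Type := Fin 3 → ℝ

/-- Euclidean inner product on ℝ³. -/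
def dot3 (a b : V3) : ℝ := ∑ i, a i * b i

/-- Cross product on ℝ³. -/
def cross3 (a b : V3) : V3 :=
  ![a 1 * b 2 - a 2 * b 1, a 2 * b 0 - a 0 * b 2, a 0 * b 1 - a 1 * b 0]

/-- Euclidean norm on ℝ³. -/
def eNorm3 (a : V3) : ℝ := Real.sqrt (∑ i, (a i) ^ 2)

/-- 3×3 real matrices. -/
abbrev Mat3 : Type := Matrix (Fin 3) (Fin 3) ℝ

/-- A state is a tuple V = (u, S, B, E). -/
abbrev MHDState : Type := V3 × Mat3 × V3 × V3

/-- The Euclidean norm on the state space. -/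
def stateNorm (V : MHDState) : ℝ :=
  Real.sqrt ((∑ i, (V.1 i) ^ 2) + (∑ i, ∑ j, (V.2.1 i j) ^ 2) +
    (∑ i, (V.2.2.1 i) ^ 2) + (∑ i, (V.2.2.2 i) ^ 2))

/-- ξ = (ξ_x, ξ_t) annihilates the state V = (u, S, B, E) if ξ_x·u = 0, ξ_x·B = 0,
ξ_t u + S ξ_x = 0 and ξ_t B + ξ_x × E = 0. -/
def Annihilates (ξx : V3) (ξt : ℝ) (V : MHDState) : Prop :=
  dot3 ξx V.1 = 0 ∧ dot3 ξx V.2.2.1 = 0 ∧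
  ξt • V.1 + V.2.1.mulVec ξx = 0 ∧
  ξt • V.2.2.1 + cross3 ξx V.2.2.2 = 0

/-- The wave cone Λ: states with symmetric S admitting some ξ with ξ_x ≠ 0
annihilating them. -/
def WaveCone : Set MHDState :=
  {V | V.2.1.IsSymm ∧ ∃ ξx : V3, ∃ ξt : ℝ, ξx ≠ 0 ∧ Annihilates ξx ξt V}

/-- The set ℳ of states (with symmetric S) satisfying B·E = 0. -/
def MSet : Set MHDState :=
  {V | V.2.1.IsSymm ∧ dot3 V.2.2.1 V.2.2.2 = 0}

/-- The segment [V₀ − (1−λ)V, V₀ + λV] is a good Λ-segment. -/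
def GoodSegment (V₀ V : MHDState) (lam : ℝ) : Prop :=
  V₀ ∈ MSet ∧ V ∈ WaveCone ∧ 0 < lam ∧ lam < 1 ∧
  (∀ t : ℝ, -(1 - lam) ≤ t → t ≤ lam → V₀ + t • V ∈ MSet) ∧
  ∃ ξx : V3, ∃ ξt : ℝ, ξx ≠ 0 ∧ Annihilates ξx ξt V ∧
    ((V.2.2.1 = 0 ∧ V.2.2.2 = 0) ∨
     (dot3 ξx V₀.2.2.1 ≠ 0 ∨ ξt • V₀.2.2.1 + cross3 ξx V₀.2.2.2 ≠ 0) ∨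
     (∃ k : ℝ, k ≠ -(1 / lam) ∧ k ≠ 1 / (1 - lam) ∧
       V.2.2.1 = k • V₀.2.2.1 ∧ V.2.2.2 = k • V₀.2.2.2 ∧
       ¬(V.2.2.1 = 0 ∧ V.2.2.2 = 0)) ∨
     (V.1 = 0 ∧ V.2.1 = 0 ∧ V₀.2.2.1 = 0 ∧ V₀.2.2.2 = 0))

/-- The iterated lamination sets Y^{N,Λ}. -/
def lamHull (Y : Set MHDState) : ℕ → Set MHDState
  | 0 => Y
  | N + 1 => lamHull Y N ∪
      {Z | ∃ lam : ℝ, ∃ V W : MHDState, 0 ≤ lam ∧ lam ≤ 1 ∧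
        V ∈ lamHull Y N ∧ W ∈ lamHull Y N ∧ V - W ∈ WaveCone ∧
        Z = lam • V + (1 - lam) • W}

/-- The lamination convex hull Y^{lc,Λ}. -/
def lcHull (Y : Set MHDState) : Set MHDState := ⋃ N : ℕ, lamHull Y N

/-- The iterated good lamination sets Y^{k,Λ_g}. -/
def lamHullG (Y : Set MHDState) : ℕ → Set MHDState
  | 0 => Y
  | k + 1 => lamHullG Y k ∪
      {V₀ | ∃ lam : ℝ, ∃ V : MHDState, GoodSegment V₀ V lam ∧
        V₀ + lam • V ∈ lamHullG Y k ∧ V₀ - (1 - lam) • V ∈ lamHullG Y k}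

/-- The good lamination convex hull Y^{lc,Λ_g}. -/
def lcHullG (Y : Set MHDState) : Set MHDState := ⋃ k : ℕ, lamHullG Y k

/-- A set of states is relatively open in ℳ. -/
def RelOpen (U : Set MHDState) : Prop :=
  ∀ V ∈ U, ∃ δ : ℝ, 0 < δ ∧ ∀ W ∈ MSet, stateNorm (W - V) < δ → W ∈ U

/-- The tensor product a⊗b of two vectors in ℝ³. -/
def outer (a b : V3) : Mat3 := Matrix.of fun i j => a i * b j

/-- The constitutive set K_{r,s}. -/
def Kset (r s : ℝ) : Set MHDState :=
  {V | ∃ q : ℝ, |q| ≤ r * s ∧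
    V.2.1 = outer V.1 V.1 - outer V.2.2.1 V.2.2.1 + q • (1 : Mat3) ∧
    V.2.2.2 = cross3 V.2.2.1 V.1 ∧
    eNorm3 (V.1 + V.2.2.1) = r ∧ eNorm3 (V.1 - V.2.2.1) = s}

/-- 𝒰_{r,s}: the relative interior of K_{r,s}^{lc,Λ} in ℳ. -/
def Uset (r s : ℝ) : Set MHDState :=
  {V | V ∈ MSet ∧ ∃ δ : ℝ, 0 < δ ∧
    ∀ W ∈ MSet, stateNorm (W - V) < δ → W ∈ lcHull (Kset r s)}

/-- The Frobenius norm on 3×3 matrices. -/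
def frobNorm (M : Mat3) : ℝ := Real.sqrt (∑ i, ∑ j, (M i j) ^ 2)

/-- The relatively open sets 𝒱_{r',s',c}. -/
def Vset (r' s' c : ℝ) : Set MHDState :=
  {V | V.2.1.IsSymm ∧ dot3 V.2.2.1 V.2.2.2 = 0 ∧ ∃ q : ℝ,
    eNorm3 (V.1 + V.2.2.1) < r' + c ∧ eNorm3 (V.1 - V.2.2.1) < s' + c ∧
    frobNorm (V.2.1 - (outer V.1 V.1 - outer V.2.2.1 V.2.2.1) - q • (1 : Mat3)) < c ∧
    |q| < r' * s' + c ∧ eNorm3 (V.2.2.2 - cross3 V.2.2.1 V.1) < c}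

open Filter Topology

/-! ### Vector algebra in ℝ³ -/

lemma dot3_eq (a b : V3) : dot3 a b = a 0 * b 0 + a 1 * b 1 + a 2 * b 2 := by
  simp [dot3, Fin.sum_univ_three]

@[simp] lemma cross3_zero_apply (a b : V3) : cross3 a b 0 = a 1 * b 2 - a 2 * b 1 := rfl
@[simp] lemma cross3_one_apply (a b : V3) : cross3 a b 1 = a 2 * b 0 - a 0 * b 2 := rfl
@[simp] lemma cross3_two_apply (a b : V3) : cross3 a b 2 = a 0 * b 1 - a 1 * b 0 := rfl

lemma V3.ext3 {a b : V3} (h0 : a 0 = b 0) (h1 : a 1 = b 1) (h2 : a 2 = b 2) : a = b := by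
  funext i
  fin_cases i <;> assumption

lemma mulVec3_apply (S : Mat3) (x : V3) (i : Fin 3) :
    S.mulVec x i = S i 0 * x 0 + S i 1 * x 1 + S i 2 * x 2 := by
  simp [Matrix.mulVec, dotProduct, Fin.sum_univ_three]

@[simp] lemma outer_apply (a b : V3) (i j : Fin 3) : outer a b i j = a i * b j := rfl

lemma dot3_self_nonneg (a : V3) : 0 ≤ dot3 a a := by
  rw [dot3_eq]; nlinarith [sq_nonneg (a 0), sq_nonneg (a 1), sq_nonneg (a 2)]

lemma dot3_self_eq_zero {a : V3} (h : dot3 a a = 0) : a = 0 := by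
  rw [dot3_eq] at h
  apply V3.ext3 <;> simp only [Pi.zero_apply] <;>
    nlinarith [sq_nonneg (a 0), sq_nonneg (a 1), sq_nonneg (a 2)]

lemma dot3_self_pos {a : V3} (h : a ≠ 0) : 0 < dot3 a a :=
  lt_of_le_of_ne (dot3_self_nonneg a) fun h' => h (dot3_self_eq_zero h'.symm)

lemma continuous_dot3 {X : Type*} [TopologicalSpace X] {f g : X → V3} (hf : Continuous f)
    (hg : Continuous g) : Continuous fun x => dot3 (f x) (g x) := by
  simp only [dot3_eq]
  fun_prop

lemma continuous_cross3 {X : Type*} [TopologicalSpace X] {f g : X → V3} (hf : Continuous f)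
    (hg : Continuous g) : Continuous fun x => cross3 (f x) (g x) := by
  refine continuous_pi fun i => ?_
  fin_cases i <;> simp <;> fun_prop

lemma continuous_outer {X : Type*} [TopologicalSpace X] {f g : X → V3} (hf : Continuous f)
    (hg : Continuous g) : Continuous fun x => outer (f x) (g x) := by
  refine continuous_matrix fun i j => ?_
  simp only [outer_apply]
  fun_prop

attribute [fun_prop] continuous_dot3 continuous_cross3 continuous_outer

lemma exists_perp₂ (a b : V3) : ∃ x : V3, x ≠ 0 ∧ dot3 x a = 0 ∧ dot3 x b = 0 := by
  obtain ⟨x, hx, h⟩ := (Matrix.exists_mulVec_eq_zero_iff (M := (Matrix.of ![a, b, 0] : Mat3))).mpr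
    (by simp [Matrix.det_fin_three])
  refine ⟨x, hx, ?_, ?_⟩
  · have := congrFun h 0
    simp [mulVec3_apply] at this
    rw [dot3_eq]; linarith
  · have := congrFun h 1
    simp [mulVec3_apply] at this
    rw [dot3_eq]; linarith

lemma exists_unit_smul {a : V3} (h : a ≠ 0) :
    ∃ (κ : ℝ) (e : V3), dot3 e e = 1 ∧ a = κ • e := by
  have hp := dot3_self_pos h
  have hs : Real.sqrt (dot3 a a) ≠ 0 := (Real.sqrt_pos.mpr hp).ne'
  have hq := Real.mul_self_sqrt hp.le
  refine ⟨Real.sqrt (dot3 a a), (Real.sqrt (dot3 a a))⁻¹ • a, ?_, ?_⟩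
  · have : dot3 ((Real.sqrt (dot3 a a))⁻¹ • a) ((Real.sqrt (dot3 a a))⁻¹ • a)
        = (Real.sqrt (dot3 a a))⁻¹ * (Real.sqrt (dot3 a a))⁻¹ * dot3 a a := by
      simp only [dot3_eq a a, dot3_eq (_ • a), Pi.smul_apply, smul_eq_mul]; ring
    rw [this]
    field_simp
    rw [sq, hq]
  · rw [smul_smul, mul_inv_cancel₀ hs, one_smul]

lemma exists_unit_perp (a : V3) : ∃ e : V3, dot3 e e = 1 ∧ dot3 e a = 0 := by
  obtain ⟨x, hx, h, -⟩ := exists_perp₂ a a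
  obtain ⟨κ, e, he, rfl⟩ := exists_unit_smul hx
  refine ⟨e, he, ?_⟩
  have hκ : κ ≠ 0 := by rintro rfl; simp at hx
  have : dot3 (κ • e) a = κ * dot3 e a := by
    simp only [dot3_eq, Pi.smul_apply, smul_eq_mul]; ring
  rw [this] at h
  exact (mul_eq_zero.mp h).resolve_left hκ

/-- A pair `B ⟂ E` is the simple two-form `(e, 0) ∧ (B × e, κ)` for some unit vector `e`. -/
lemma exists_unit_frame {B E : V3} (h : dot3 B E = 0) :
    ∃ (κ : ℝ) (e : V3), dot3 e e = 1 ∧ dot3 e B = 0 ∧ E = κ • e := by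
  by_cases hE : E = 0
  · obtain ⟨e, he, heB⟩ := exists_unit_perp B
    exact ⟨0, e, he, heB, by simp [hE]⟩
  · obtain ⟨κ, e, he, rfl⟩ := exists_unit_smul hE
    refine ⟨κ, e, he, ?_, rfl⟩
    have hκ : κ ≠ 0 := by rintro rfl; simp at hE
    have : dot3 B (κ • e) = κ * dot3 e B := by
      simp only [dot3_eq, Pi.smul_apply, smul_eq_mul]; ring
    rw [this] at h
    exact (mul_eq_zero.mp h).resolve_left hκ

/-! ### The norm topology on states -/

lemma stateNorm_zero : stateNorm 0 = 0 := by simp [stateNorm]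

lemma continuous_stateNorm : Continuous stateNorm := by
  unfold stateNorm
  fun_prop

lemma abs_u_le_stateNorm (V : MHDState) (i : Fin 3) : |V.1 i| ≤ stateNorm V := by
  rw [← Real.sqrt_sq_eq_abs]
  refine Real.sqrt_le_sqrt ?_
  have h1 := Finset.single_le_sum (f := fun i => (V.1 i) ^ 2) (fun i _ => sq_nonneg _)
    (Finset.mem_univ i)
  have h2 : 0 ≤ ∑ i, ∑ j, (V.2.1 i j) ^ 2 := by positivity
  have h3 : 0 ≤ ∑ i, (V.2.2.1 i) ^ 2 := by positivity
  have h4 : 0 ≤ ∑ i, (V.2.2.2 i) ^ 2 := by positivity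
  linarith

lemma abs_S_le_stateNorm (V : MHDState) (i j : Fin 3) : |V.2.1 i j| ≤ stateNorm V := by
  rw [← Real.sqrt_sq_eq_abs]
  refine Real.sqrt_le_sqrt ?_
  have h1 := Finset.single_le_sum (f := fun j => (V.2.1 i j) ^ 2) (fun i _ => sq_nonneg _)
    (Finset.mem_univ j)
  have h2 := Finset.single_le_sum (f := fun i => ∑ j, (V.2.1 i j) ^ 2)
    (fun i _ => by positivity) (Finset.mem_univ i)
  have h0 : 0 ≤ ∑ i, (V.1 i) ^ 2 := by positivity
  have h3 : 0 ≤ ∑ i, (V.2.2.1 i) ^ 2 := by positivity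
  have h4 : 0 ≤ ∑ i, (V.2.2.2 i) ^ 2 := by positivity
  linarith

lemma abs_B_le_stateNorm (V : MHDState) (i : Fin 3) : |V.2.2.1 i| ≤ stateNorm V := by
  rw [← Real.sqrt_sq_eq_abs]
  refine Real.sqrt_le_sqrt ?_
  have h1 := Finset.single_le_sum (f := fun i => (V.2.2.1 i) ^ 2) (fun i _ => sq_nonneg _)
    (Finset.mem_univ i)
  have h2 : 0 ≤ ∑ i, ∑ j, (V.2.1 i j) ^ 2 := by positivity
  have h3 : 0 ≤ ∑ i, (V.1 i) ^ 2 := by positivity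
  have h4 : 0 ≤ ∑ i, (V.2.2.2 i) ^ 2 := by positivity
  linarith

lemma abs_E_le_stateNorm (V : MHDState) (i : Fin 3) : |V.2.2.2 i| ≤ stateNorm V := by
  rw [← Real.sqrt_sq_eq_abs]
  refine Real.sqrt_le_sqrt ?_
  have h1 := Finset.single_le_sum (f := fun i => (V.2.2.2 i) ^ 2) (fun i _ => sq_nonneg _)
    (Finset.mem_univ i)
  have h2 : 0 ≤ ∑ i, ∑ j, (V.2.1 i j) ^ 2 := by positivity
  have h3 : 0 ≤ ∑ i, (V.1 i) ^ 2 := by positivity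
  have h4 : 0 ≤ ∑ i, (V.2.2.1 i) ^ 2 := by positivity
  linarith

lemma nhds_eq_comap_stateNorm (V : MHDState) :
    𝓝 V = comap (fun W => stateNorm (W - V)) (𝓝 0) := by
  apply le_antisymm
  · rw [← tendsto_iff_comap]
    have : Continuous fun W => stateNorm (W - V) :=
      continuous_stateNorm.comp (continuous_id.sub continuous_const)
    simpa [stateNorm_zero] using this.tendsto V
  · have key : Tendsto (fun W => stateNorm (W - V))
        (comap (fun W => stateNorm (W - V)) (𝓝 0)) (𝓝 0) := tendsto_comap
    have coord : ∀ (f : MHDState → ℝ), (∀ W, |f W - f V| ≤ stateNorm (W - V)) →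
        Tendsto f (comap (fun W => stateNorm (W - V)) (𝓝 0)) (𝓝 (f V)) := fun f hf =>
      tendsto_iff_dist_tendsto_zero.mpr
        (squeeze_zero (fun _ => dist_nonneg) (fun W => by rw [Real.dist_eq]; exact hf W) key)
    have h1 := tendsto_pi_nhds.mpr fun i =>
      coord (fun W => W.1 i) fun W => abs_u_le_stateNorm (W - V) i
    have h2 := tendsto_pi_nhds.mpr fun i => tendsto_pi_nhds.mpr fun j =>
      coord (fun W => W.2.1 i j) fun W => abs_S_le_stateNorm (W - V) i j
    have h3 := tendsto_pi_nhds.mpr fun i =>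
      coord (fun W => W.2.2.1 i) fun W => abs_B_le_stateNorm (W - V) i
    have h4 := tendsto_pi_nhds.mpr fun i =>
      coord (fun W => W.2.2.2 i) fun W => abs_E_le_stateNorm (W - V) i
    exact h1.prodMk_nhds (h2.prodMk_nhds (h3.prodMk_nhds h4))

lemma mem_nhdsWithin_iff_stateNorm {V : MHDState} {G : Set MHDState} :
    G ∈ 𝓝[MSet] V ↔ ∃ δ : ℝ, 0 < δ ∧ ∀ W ∈ MSet, stateNorm (W - V) < δ → W ∈ G := by
  have hb : (𝓝 V).HasBasis (fun δ : ℝ => 0 < δ) fun δ => {W | stateNorm (W - V) < δ} := by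
    rw [nhds_eq_comap_stateNorm]
    convert (Metric.nhds_basis_ball (x := (0 : ℝ))).comap (fun W => stateNorm (W - V)) using 2
    ext W
    simp [abs_of_nonneg (show 0 ≤ stateNorm (W - V) from Real.sqrt_nonneg _)]
  rw [(nhdsWithin_hasBasis hb MSet).mem_iff]
  refine exists_congr fun δ => and_congr_right fun _ => ?_
  exact ⟨fun h W hW hd => h ⟨hd, hW⟩, fun h W hW => h W hW.2 hW.1⟩

/-! ### Openness of good lamination hulls -/

/-- The pairing of the two-form `(B, E)` with the one-forms `ξ` and `a`. -/
lemma wedge_pairing (B E ξx ax : V3) (ξt at' : ℝ) :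
    dot3 B (at' • ξx - ξt • ax) + dot3 (cross3 ξx ax) E
      = at' * dot3 ξx B - dot3 ax (ξt • B + cross3 ξx E) := by
  simp only [dot3_eq, cross3_zero_apply, cross3_one_apply, cross3_two_apply, Pi.add_apply,
    Pi.sub_apply, Pi.smul_apply, smul_eq_mul]
  ring

lemma dot3_wedge_self (ξx ax : V3) (ξt at' : ℝ) :
    dot3 (cross3 ξx ax) (at' • ξx - ξt • ax) = 0 := by
  simp only [dot3_eq, cross3_zero_apply, cross3_one_apply, cross3_two_apply,
    Pi.sub_apply, Pi.smul_apply, smul_eq_mul]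
  ring

/-- A two-form annihilated by `ξ` is `ξ ∧ a` for some `a`. -/
lemma exists_wedge {ξx B E : V3} {ξt : ℝ} (hξ : ξx ≠ 0) (hB : dot3 ξx B = 0)
    (hE : ξt • B + cross3 ξx E = 0) :
    ∃ (ax : V3) (at' : ℝ), B = cross3 ξx ax ∧ E = at' • ξx - ξt • ax := by
  have hp := (dot3_self_pos hξ).ne'
  refine ⟨(dot3 ξx ξx)⁻¹ • cross3 B ξx, (dot3 ξx ξx)⁻¹ * dot3 E ξx, ?_, ?_⟩
  · have h1 : (dot3 ξx ξx)⁻¹ * dot3 ξx ξx = 1 := inv_mul_cancel₀ hp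
    generalize (dot3 ξx ξx)⁻¹ = c at *
    rw [dot3_eq] at h1 hB
    apply V3.ext3 <;>
      simp only [cross3_zero_apply, cross3_one_apply, cross3_two_apply, Pi.smul_apply, smul_eq_mul]
    · linear_combination (-B 0) * h1 + c * ξx 0 * hB
    · linear_combination (-B 1) * h1 + c * ξx 1 * hB
    · linear_combination (-B 2) * h1 + c * ξx 2 * hB
  · have h1 : (dot3 ξx ξx)⁻¹ * dot3 ξx ξx = 1 := inv_mul_cancel₀ hp
    generalize (dot3 ξx ξx)⁻¹ = c at *
    have e0 := congrFun hE 0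
    have e1 := congrFun hE 1
    have e2 := congrFun hE 2
    rw [dot3_eq] at h1 hB ⊢
    simp only [Pi.add_apply, Pi.smul_apply, Pi.zero_apply, cross3_zero_apply, cross3_one_apply,
      cross3_two_apply, smul_eq_mul] at e0 e1 e2
    apply V3.ext3 <;>
      simp only [cross3_zero_apply, cross3_one_apply, cross3_two_apply, Pi.smul_apply,
        Pi.sub_apply, smul_eq_mul]
    · linear_combination (-E 0) * h1 + c * ξx 2 * e1 - c * ξx 1 * e2
    · linear_combination (-E 1) * h1 + c * ξx 0 * e2 - c * ξx 2 * e0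
    · linear_combination (-E 2) * h1 + c * ξx 1 * e0 - c * ξx 0 * e1

lemma annihilates_wedge {ξx ax u : V3} {ξt at' : ℝ} {S : Mat3} (hu : dot3 ξx u = 0)
    (hS : ξt • u + S.mulVec ξx = 0) :
    Annihilates ξx ξt (u, S, cross3 ξx ax, at' • ξx - ξt • ax) := by
  refine ⟨hu, ?_, hS, ?_⟩
  · simp only [dot3_eq, cross3_zero_apply, cross3_one_apply, cross3_two_apply]; ring
  · apply V3.ext3 <;> simp only [cross3_zero_apply, cross3_one_apply, cross3_two_apply,
      Pi.smul_apply, Pi.add_apply, Pi.zero_apply, Pi.sub_apply, smul_eq_mul] <;> ring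

lemma dot3_line (B E B' E' : V3) (t : ℝ) : dot3 (B + t • B') (E + t • E')
    = dot3 B E + t * (dot3 B E' + dot3 B' E) + t ^ 2 * dot3 B' E' := by
  simp only [dot3_eq, Pi.add_apply, Pi.smul_apply, smul_eq_mul]; ring

lemma line_mem_MSet {W V : MHDState} (hW : W ∈ MSet) (hS : V.2.1.IsSymm)
    (h1 : dot3 W.2.2.1 V.2.2.2 + dot3 V.2.2.1 W.2.2.2 = 0) (h2 : dot3 V.2.2.1 V.2.2.2 = 0)
    (t : ℝ) : W + t • V ∈ MSet := by
  refine ⟨hW.1.add (hS.smul t), ?_⟩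
  have := dot3_line W.2.2.1 W.2.2.2 V.2.2.1 V.2.2.2 t
  rw [h1, h2, hW.2] at this
  simpa using this

/-- A set closed under good `Λ`-segments. -/
def GoodClosed (G : Set MHDState) : Prop :=
  ∀ V₀ V lam, GoodSegment V₀ V lam → V₀ + lam • V ∈ G → V₀ - (1 - lam) • V ∈ G → V₀ ∈ G

/-- The interior of `G` relative to `ℳ`. -/
def relInt (G : Set MHDState) : Set MHDState := {V | V ∈ MSet ∧ G ∈ 𝓝[MSet] V}

lemma relInt_subset (G : Set MHDState) : relInt G ⊆ G := fun _ h => mem_of_mem_nhdsWithin h.1 h.2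

lemma relInt_mem_nhdsWithin {G : Set MHDState} {V : MHDState} (h : V ∈ relInt G) :
    relInt G ∈ 𝓝[MSet] V := by
  have := eventually_eventually_nhdsWithin.mpr h.2
  filter_upwards [this, self_mem_nhdsWithin] with W hW hM using ⟨hM, hW⟩

lemma eventually_mem_relInt {ι : Type*} {l : Filter ι} {G : Set MHDState} {V : MHDState}
    (h : V ∈ relInt G) {f : ι → MHDState} (hf : Tendsto f l (𝓝 V)) (hM : ∀ᶠ x in l, f x ∈ MSet) :
    ∀ᶠ x in l, f x ∈ relInt G :=
  (tendsto_nhdsWithin_iff.mpr ⟨hf, hM⟩) (relInt_mem_nhdsWithin h)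

lemma sub_eq_add_neg_smul (V₀ V : MHDState) (lam : ℝ) :
    V₀ - (1 - lam) • V = V₀ + (-(1 - lam)) • V := by rw [neg_smul, sub_eq_add_neg]

/-- Transversal segments are stable under perturbation of the centre. -/
lemma relInt_of_transversal {G : Set MHDState} (hG : GoodClosed G) {V₀ : MHDState} {ξx ax u : V3}
    {ξt at' : ℝ} {S : Mat3} {lam : ℝ} (hl0 : 0 < lam) (hl1 : lam < 1) (hM : V₀ ∈ MSet)
    (hS : S.IsSymm) (hξ : ξx ≠ 0) (hu : dot3 ξx u = 0) (hSu : ξt • u + S.mulVec ξx = 0)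
    (hb : dot3 ξx V₀.2.2.1 ≠ 0 ∨ ξt • V₀.2.2.1 + cross3 ξx V₀.2.2.2 ≠ 0)
    (hQ : at' * dot3 ξx V₀.2.2.1 - dot3 ax (ξt • V₀.2.2.1 + cross3 ξx V₀.2.2.2) = 0)
    (h1 : V₀ + lam • ((u, S, cross3 ξx ax, at' • ξx - ξt • ax) : MHDState) ∈ relInt G)
    (h2 : V₀ - (1 - lam) • ((u, S, cross3 ξx ax, at' • ξx - ξt • ax) : MHDState) ∈ relInt G) :
    V₀ ∈ relInt G := by
  refine ⟨hM, ?_⟩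
  set β : MHDState → ℝ := fun W => dot3 ξx W.2.2.1 with hβ
  set η : MHDState → V3 := fun W => ξt • W.2.2.1 + cross3 ξx W.2.2.2 with hη
  have cβ : Continuous β := by fun_prop
  have cη : Continuous η := by fun_prop
  set D : MHDState → ℝ := fun W => β W ^ 2 + dot3 (η W) (η W) with hD
  have cD : Continuous D := by fun_prop
  have hDpos : D V₀ ≠ 0 := by
    rcases hb with h | h
    · have := sq_pos_of_ne_zero h
      have := dot3_self_nonneg (η V₀)
      simp only [hD]; positivity
    · have := dot3_self_pos h
      have := sq_nonneg (β V₀)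
      simp only [hD]; positivity
  set c : MHDState → ℝ := fun W => (at' * β W - dot3 ax (η W)) / D W with hc
  have cc : Tendsto c (𝓝 V₀) (𝓝 0) := by
    have : ContinuousAt c V₀ := by
      refine ContinuousAt.div ?_ cD.continuousAt hDpos
      exact (by fun_prop : Continuous fun W => at' * β W - dot3 ax (η W)).continuousAt
    have h0 : c V₀ = 0 := by simp only [hc]; rw [hQ, zero_div]
    rw [← h0]; exact this
  set V : MHDState × ℝ → MHDState := fun p => (u, S, cross3 ξx (ax + p.2 • η p.1),
    (at' - p.2 * β p.1) • ξx - ξt • (ax + p.2 • η p.1)) with hV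
  have cV : Continuous V := by fun_prop
  have tV : ∀ t : ℝ, Tendsto (fun W => W + t • V (W, c W)) (𝓝 V₀)
      (𝓝 (V₀ + t • ((u, S, cross3 ξx ax, at' • ξx - ξt • ax) : MHDState))) := by
    intro t
    have h := ((by fun_prop : Continuous fun p : MHDState × ℝ => p.1 + t • V p).tendsto
      (V₀, 0)).comp ((tendsto_id (α := MHDState) (x := 𝓝 V₀)).prodMk_nhds cc)
    simpa [hV, Function.comp_def] using h
  have hline : ∀ W ∈ MSet, D W ≠ 0 → ∀ t : ℝ, W + t • V (W, c W) ∈ MSet := by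
    intro W hW hDW t
    refine line_mem_MSet hW hS ?_ (dot3_wedge_self _ _ _ _) t
    have := wedge_pairing W.2.2.1 W.2.2.2 ξx (ax + c W • η W) ξt (at' - c W * β W)
    refine this.trans ?_
    have e1 : dot3 (ax + c W • η W) (η W) = dot3 ax (η W) + c W * dot3 (η W) (η W) := by
      simp only [dot3_eq, Pi.add_apply, Pi.smul_apply, smul_eq_mul]; ring
    have e2 : c W * D W = at' * β W - dot3 ax (η W) := div_mul_cancel₀ _ hDW
    change (at' - c W * β W) * β W - dot3 (ax + c W • η W) (η W) = 0
    rw [e1]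
    simp only [hD] at e2
    linarith
  have evD : ∀ᶠ W in 𝓝[MSet] V₀, D W ≠ 0 :=
    nhdsWithin_le_nhds (cD.continuousAt.eventually_ne hDpos)
  have evM : ∀ᶠ W in 𝓝[MSet] V₀, W ∈ MSet := self_mem_nhdsWithin
  have evL : ∀ t : ℝ, ∀ᶠ W in 𝓝[MSet] V₀, W + t • V (W, c W) ∈ MSet := fun t => by
    filter_upwards [evD, evM] with W h h' using hline W h' h t
  rw [sub_eq_add_neg_smul] at h2
  filter_upwards [evD, evM, eventually_mem_relInt h1 ((tV lam).mono_left nhdsWithin_le_nhds) (evL _),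
    eventually_mem_relInt h2 ((tV _).mono_left nhdsWithin_le_nhds) (evL _)] with W hDW hW hp hm
  have hann : Annihilates ξx ξt (V (W, c W)) := annihilates_wedge hu hSu
  refine hG W (V (W, c W)) lam ⟨hW, ⟨hS, ξx, ξt, hξ, hann⟩, hl0, hl1,
    fun t _ _ => hline W hW hDW t, ξx, ξt, hξ, hann, Or.inr (Or.inl ?_)⟩
    (relInt_subset G hp) (by rw [sub_eq_add_neg_smul]; exact relInt_subset G hm)
  by_contra hcon
  push Not at hcon
  apply hDW
  simp only [hD, hβ, hη, hcon.1, hcon.2]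
  simp [dot3_eq]

/-- Deforming `(u, S)` along with the direction `ξ` annihilating it. -/
lemma exists_deformation {ξx u : V3} {ξt : ℝ} {S : Mat3} (cx : V3) (ct : ℝ) (hS : S.IsSymm)
    (hξ : ξx ≠ 0) (hu : dot3 ξx u = 0) (hSu : ξt • u + S.mulVec ξx = 0) :
    ∃ (u' : ℝ → V3) (S' : ℝ → Mat3), ContinuousAt u' 0 ∧ ContinuousAt S' 0 ∧ u' 0 = u ∧ S' 0 = S ∧
      ∀ᶠ δ in 𝓝 (0 : ℝ), ξx + δ • cx ≠ 0 ∧ (S' δ).IsSymm ∧ dot3 (ξx + δ • cx) (u' δ) = 0 ∧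
        (ξt + δ * ct) • u' δ + (S' δ).mulVec (ξx + δ • cx) = 0 := by
  set x : ℝ → V3 := fun δ => ξx + δ • cx with hx
  have cxx : Continuous x := by fun_prop
  have cN : Continuous fun δ => dot3 (x δ) (x δ) := by fun_prop
  have hN0 : dot3 (x 0) (x 0) ≠ 0 := by simpa [hx] using (dot3_self_pos hξ).ne'
  set inv : ℝ → ℝ := fun δ => (dot3 (x δ) (x δ))⁻¹ with hinv
  have cinv : ContinuousAt inv 0 := cN.continuousAt.inv₀ hN0
  set u' : ℝ → V3 := fun δ => u - (inv δ * dot3 (x δ) u) • x δ with hu'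
  set y : ℝ → V3 := fun δ => -((ξt + δ * ct) • u' δ) - S.mulVec (x δ) with hy
  set S' : ℝ → Mat3 := fun δ => S + inv δ • (outer (y δ) (x δ) + outer (x δ) (y δ)) -
    (dot3 (x δ) (y δ) * inv δ ^ 2) • outer (x δ) (x δ) with hS'
  have cpair : ContinuousAt (fun δ : ℝ => (δ, inv δ)) 0 := continuousAt_id.prodMk cinv
  set U : ℝ × ℝ → V3 := fun p => u - (p.2 * dot3 (x p.1) u) • x p.1 with hU
  have cU : Continuous U := by fun_prop
  set Y : ℝ × ℝ → V3 := fun p => -((ξt + p.1 * ct) • U p) - S.mulVec (x p.1) with hY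
  have cY : Continuous Y := by fun_prop
  have cS : Continuous fun p : ℝ × ℝ => S + p.2 • (outer (Y p) (x p.1) + outer (x p.1) (Y p)) -
    (dot3 (x p.1) (Y p) * p.2 ^ 2) • outer (x p.1) (x p.1) := by fun_prop
  have hu0 : u' 0 = u := by simp [hu', hx, hu]
  have hy0 : y 0 = 0 := by
    have hx0 : x 0 = ξx := by simp [hx]
    simp only [hy, hu0]
    rw [hx0, zero_mul, add_zero, ← neg_add', hSu, neg_zero]
  refine ⟨u', S', ContinuousAt.comp (f := fun δ : ℝ => (δ, inv δ)) cU.continuousAt cpair,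
    ContinuousAt.comp (f := fun δ : ℝ => (δ, inv δ)) cS.continuousAt cpair, hu0, ?_, ?_⟩
  · simp only [hS', hy0]
    ext i j
    simp [dot3_eq]
  · filter_upwards [cN.continuousAt.eventually_ne hN0] with δ hδ
    have hI : inv δ * dot3 (x δ) (x δ) = 1 := inv_mul_cancel₀ hδ
    refine ⟨?_, ?_, ?_, ?_⟩
    · intro h
      apply hδ
      change dot3 (ξx + δ • cx) (ξx + δ • cx) = 0
      simp [h, dot3_eq]
    · refine Matrix.IsSymm.ext fun i j => ?_
      simp only [hS', Matrix.sub_apply, Matrix.add_apply, Matrix.smul_apply, outer_apply,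
        smul_eq_mul, hS.apply i j]
      ring
    · have : dot3 (x δ) (u' δ) = dot3 (x δ) u - inv δ * dot3 (x δ) (x δ) * dot3 (x δ) u := by
        simp only [hu', dot3_eq, Pi.sub_apply, Pi.smul_apply, smul_eq_mul]; ring
      change dot3 (x δ) (u' δ) = 0
      rw [this, hI]; ring
    · have hmul : (S' δ).mulVec (x δ) = y δ + S.mulVec (x δ) := by
        funext i
        simp only [Pi.add_apply, mulVec3_apply, hS', Matrix.sub_apply, Matrix.add_apply,
          Matrix.smul_apply, outer_apply, smul_eq_mul]
        rw [dot3_eq] at hI ⊢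
        linear_combination (y δ i - x δ i * inv δ *
          (x δ 0 * y δ 0 + x δ 1 * y δ 1 + x δ 2 * y δ 2)) * hI
      change (ξt + δ * ct) • u' δ + (S' δ).mulVec (x δ) = 0
      rw [hmul]
      simp [hy]

/-- If `ω₀ ≠ 0` is annihilated by `ξ`, then some `c` not annihilating `ω₀` has
`ω₀ ∧ c ∧ a = 0`. -/
lemma exists_transversal {B E : V3} (h : ¬(B = 0 ∧ E = 0)) (ax : V3) (at' : ℝ) :
    ∃ (cx : V3) (ct : ℝ), (dot3 cx B ≠ 0 ∨ ct • B + cross3 cx E ≠ 0) ∧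
      at' * dot3 cx B - dot3 ax (ct • B + cross3 cx E) = 0 := by
  by_cases ha : dot3 ax B ≠ 0 ∨ at' • B + cross3 ax E ≠ 0
  · refine ⟨ax, at', ha, ?_⟩
    simp only [dot3_eq, Pi.add_apply, Pi.smul_apply, smul_eq_mul, cross3_zero_apply,
      cross3_one_apply, cross3_two_apply]
    ring
  push Not at ha
  obtain ⟨ha1, ha2⟩ := ha
  have key : ∀ (cx : V3) (ct : ℝ), at' * dot3 cx B - dot3 ax (ct • B + cross3 cx E) = 0 := by
    intro cx ct
    have e0 := congrFun ha2 0
    have e1 := congrFun ha2 1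
    have e2 := congrFun ha2 2
    simp only [dot3_eq, Pi.add_apply, Pi.smul_apply, smul_eq_mul, cross3_zero_apply,
      cross3_one_apply, cross3_two_apply, Pi.zero_apply] at *
    linear_combination (-ct) * ha1 + cx 0 * e0 + cx 1 * e1 + cx 2 * e2
  by_cases hB : B = 0
  · have hE : E ≠ 0 := fun hE => h ⟨hB, hE⟩
    obtain ⟨e, he, heE⟩ := exists_unit_perp E
    refine ⟨e, 0, Or.inr fun hc => hE ?_, key _ _⟩
    rw [zero_smul, zero_add] at hc
    have e0 := congrFun hc 0
    have e1 := congrFun hc 1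
    have e2 := congrFun hc 2
    simp only [dot3_eq, cross3_zero_apply, cross3_one_apply, cross3_two_apply,
      Pi.zero_apply] at *
    apply V3.ext3 <;> simp only [Pi.zero_apply]
    · linear_combination (-E 0) * he + e 0 * heE + e 2 * e1 - e 1 * e2
    · linear_combination (-E 1) * he + e 1 * heE + e 0 * e2 - e 2 * e0
    · linear_combination (-E 2) * he + e 2 * heE + e 1 * e0 - e 0 * e1
  · exact ⟨B, 0, Or.inl (dot3_self_pos hB).ne', key _ _⟩

lemma dot3_zero_left (a : V3) : dot3 0 a = 0 := by simp [dot3_eq]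
lemma dot3_zero_right (a : V3) : dot3 a 0 = 0 := by simp [dot3_eq]

lemma waveCone_dot3_eq_zero {V : MHDState} (h : V ∈ WaveCone) : dot3 V.2.2.1 V.2.2.2 = 0 := by
  obtain ⟨-, ξx, ξt, hξ, -, hB, -, hE⟩ := h
  obtain ⟨ax, at', h1, h2⟩ := exists_wedge hξ hB hE
  rw [h1, h2, dot3_wedge_self]

/-- The centre of a `Λ`-segment with endpoints in `ℳ` lies in `ℳ`, and the two-forms pair to
zero. -/
lemma center_mem_MSet {V₀ V : MHDState} {lam : ℝ} (hV : V ∈ WaveCone)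
    (h1 : V₀ + lam • V ∈ MSet) (h2 : V₀ - (1 - lam) • V ∈ MSet) :
    V₀ ∈ MSet ∧ dot3 V₀.2.2.1 V.2.2.2 + dot3 V.2.2.1 V₀.2.2.2 = 0 := by
  rw [sub_eq_add_neg_smul] at h2
  have q := waveCone_dot3_eq_zero hV
  have e1 : dot3 (V₀.2.2.1 + lam • V.2.2.1) (V₀.2.2.2 + lam • V.2.2.2) = 0 := h1.2
  have e2 : dot3 (V₀.2.2.1 + (-(1 - lam)) • V.2.2.1) (V₀.2.2.2 + (-(1 - lam)) • V.2.2.2) = 0 :=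
    h2.2
  rw [dot3_line, q] at e1 e2
  have hQ : dot3 V₀.2.2.1 V.2.2.2 + dot3 V.2.2.1 V₀.2.2.2 = 0 := by linarith
  refine ⟨⟨?_, ?_⟩, hQ⟩
  · have hs := h1.1.sub (hV.1.smul lam)
    have e : (V₀ + lam • V).2.1 - lam • V.2.1 = V₀.2.1 := add_sub_cancel_right _ _
    rwa [e] at hs
  · rw [hQ] at e1; linarith

lemma relInt_of_ne_zero {G : Set MHDState} (hG : GoodClosed G) {V₀ V : MHDState} {lam : ℝ}
    (hl0 : 0 < lam) (hl1 : lam < 1) (hV : V ∈ WaveCone) (hne : ¬(V₀.2.2.1 = 0 ∧ V₀.2.2.2 = 0))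
    (h1 : V₀ + lam • V ∈ relInt G) (h2 : V₀ - (1 - lam) • V ∈ relInt G) : V₀ ∈ relInt G := by
  obtain ⟨hM, hQ⟩ := center_mem_MSet hV h1.1 h2.1
  obtain ⟨u, S, B, E⟩ := V
  obtain ⟨hS, ξx, ξt, hξ, hu, hB, hSu, hE⟩ := hV
  dsimp only at hS hu hB hSu hE hQ
  obtain ⟨ax, at', rfl, rfl⟩ := exists_wedge hξ hB hE
  rw [wedge_pairing] at hQ
  by_cases hb : dot3 ξx V₀.2.2.1 ≠ 0 ∨ ξt • V₀.2.2.1 + cross3 ξx V₀.2.2.2 ≠ 0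
  · exact relInt_of_transversal hG hl0 hl1 hM hS hξ hu hSu hb hQ h1 h2
  push Not at hb
  obtain ⟨hb1, hb2⟩ := hb
  obtain ⟨cx, ct, hc, hca⟩ := exists_transversal hne ax at'
  obtain ⟨u', S', cu, cS, u0, S0, hev⟩ := exists_deformation cx ct hS hξ hu hSu
  set V : ℝ → MHDState := fun δ => (u' δ, S' δ, cross3 (ξx + δ • cx) ax,
    at' • (ξx + δ • cx) - (ξt + δ * ct) • ax) with hVdef
  have cV : ContinuousAt V 0 := by
    refine cu.prodMk (cS.prodMk (Continuous.continuousAt ?_))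
    fun_prop
  have V0 : V 0 = (u, S, cross3 ξx ax, at' • ξx - ξt • ax) := by simp [hVdef, u0, S0]
  have tV : ∀ t : ℝ, Tendsto (fun δ => V₀ + t • V δ) (𝓝[≠] 0)
      (𝓝 (V₀ + t • ((u, S, cross3 ξx ax, at' • ξx - ξt • ax) : MHDState))) := by
    intro t
    rw [← V0]
    exact (tendsto_const_nhds.add (cV.const_smul t)).mono_left nhdsWithin_le_nhds
  have eβ : ∀ δ : ℝ, dot3 (ξx + δ • cx) V₀.2.2.1 = δ * dot3 cx V₀.2.2.1 := by
    intro δ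
    have : dot3 (ξx + δ • cx) V₀.2.2.1 = dot3 ξx V₀.2.2.1 + δ * dot3 cx V₀.2.2.1 := by
      simp only [dot3_eq, Pi.add_apply, Pi.smul_apply, smul_eq_mul]; ring
    rw [this, hb1, zero_add]
  have eη : ∀ δ : ℝ, (ξt + δ * ct) • V₀.2.2.1 + cross3 (ξx + δ • cx) V₀.2.2.2
      = δ • (ct • V₀.2.2.1 + cross3 cx V₀.2.2.2) := by
    intro δ
    have : (ξt + δ * ct) • V₀.2.2.1 + cross3 (ξx + δ • cx) V₀.2.2.2
        = (ξt • V₀.2.2.1 + cross3 ξx V₀.2.2.2) + δ • (ct • V₀.2.2.1 + cross3 cx V₀.2.2.2) := by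
      apply V3.ext3 <;> simp only [cross3_zero_apply, cross3_one_apply, cross3_two_apply,
        Pi.smul_apply, Pi.add_apply, smul_eq_mul] <;> ring
    rw [this, hb2, zero_add]
  have eQ : ∀ δ : ℝ, at' * dot3 (ξx + δ • cx) V₀.2.2.1 -
      dot3 ax ((ξt + δ * ct) • V₀.2.2.1 + cross3 (ξx + δ • cx) V₀.2.2.2) = 0 := by
    intro δ
    have : dot3 ax (δ • (ct • V₀.2.2.1 + cross3 cx V₀.2.2.2)) =
        δ * dot3 ax (ct • V₀.2.2.1 + cross3 cx V₀.2.2.2) := by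
      simp only [dot3_eq, Pi.add_apply, Pi.smul_apply, smul_eq_mul]; ring
    rw [eβ, eη, this]
    linear_combination δ * hca
  have hev' := hev.filter_mono (nhdsWithin_le_nhds (s := {0}ᶜ))
  have evL : ∀ t : ℝ, ∀ᶠ δ in 𝓝[≠] (0 : ℝ), V₀ + t • V δ ∈ MSet := by
    intro t
    filter_upwards [hev'] with δ hδ
    refine line_mem_MSet hM hδ.2.1 ?_ (dot3_wedge_self _ _ _ _) t
    exact (wedge_pairing _ _ _ _ _ _).trans (eQ δ)
  rw [sub_eq_add_neg_smul] at h2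
  obtain ⟨δ, hδ, hp, hm, hδ0⟩ := (hev'.and ((eventually_mem_relInt h1 (tV _) (evL _)).and
    ((eventually_mem_relInt h2 (tV _) (evL _)).and self_mem_nhdsWithin))).exists
  refine relInt_of_transversal hG hl0 hl1 hM hδ.2.1 hδ.1 hδ.2.2.1 hδ.2.2.2 ?_ (eQ δ) hp ?_
  · rw [eβ, eη]
    exact hc.imp (mul_ne_zero hδ0) (smul_ne_zero hδ0)
  · rw [sub_eq_add_neg_smul]; exact hm

lemma relInt_of_hydrodynamic {G : Set MHDState} (hG : GoodClosed G) {V₀ V : MHDState} {lam : ℝ}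
    (hl0 : 0 < lam) (hl1 : lam < 1) (hV : V ∈ WaveCone) (hB : V.2.2.1 = 0) (hE : V.2.2.2 = 0)
    (h1 : V₀ + lam • V ∈ relInt G) (h2 : V₀ - (1 - lam) • V ∈ relInt G) : V₀ ∈ relInt G := by
  obtain ⟨hM, -⟩ := center_mem_MSet hV h1.1 h2.1
  refine ⟨hM, ?_⟩
  have hline : ∀ W ∈ MSet, ∀ t : ℝ, W + t • V ∈ MSet := fun W hW t =>
    line_mem_MSet hW hV.1 (by rw [hB, hE, dot3_zero_left, dot3_zero_right, add_zero])
      (waveCone_dot3_eq_zero hV) t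
  have ev : ∀ t : ℝ, V₀ + t • V ∈ relInt G → ∀ᶠ W in 𝓝[MSet] V₀, W + t • V ∈ relInt G := by
    intro t ht
    refine eventually_mem_relInt ht ?_ (eventually_of_mem self_mem_nhdsWithin fun W hW =>
      hline W hW t)
    exact ((continuous_id.add continuous_const).tendsto V₀).mono_left nhdsWithin_le_nhds
  rw [sub_eq_add_neg_smul] at h2
  filter_upwards [ev _ h1, ev _ h2, self_mem_nhdsWithin] with W hp hm hW
  obtain ⟨ξx, ξt, hξ, hann⟩ := hV.2
  exact hG W V lam ⟨hW, hV, hl0, hl1, fun t _ _ => hline W hW t, ξx, ξt, hξ, hann,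
    Or.inl ⟨hB, hE⟩⟩ (relInt_subset G hp)
    (by rw [sub_eq_add_neg_smul]; exact relInt_subset G hm)

lemma mem_WaveCone_of_magnetic {B E : V3} (h : dot3 B E = 0) :
    ((0, 0, B, E) : MHDState) ∈ WaveCone := by
  obtain ⟨κ, e, he, heB, rfl⟩ := exists_unit_frame h
  refine ⟨Matrix.isSymm_zero, e, 0, ?_, dot3_zero_right e, heB, by simp, ?_⟩
  · rintro rfl
    simp [dot3_eq] at he
  · apply V3.ext3 <;> simp <;> ring

lemma stateNorm_lt {V : MHDState} {d : ℝ} (hd : 0 < d) (hu : ∀ i, |V.1 i| ≤ d)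
    (hS : ∀ i j, |V.2.1 i j| ≤ d) (hB : ∀ i, |V.2.2.1 i| ≤ d) (hE : ∀ i, |V.2.2.2 i| ≤ d) :
    stateNorm V < 5 * d := by
  have sq_le : ∀ x : ℝ, |x| ≤ d → x ^ 2 ≤ d ^ 2 := fun x hx => by
    rw [← sq_abs]; gcongr
  have h1 : ∑ i, (V.1 i) ^ 2 ≤ ∑ _i : Fin 3, d ^ 2 := Finset.sum_le_sum fun i _ => sq_le _ (hu i)
  have h2 : ∑ i, ∑ j, (V.2.1 i j) ^ 2 ≤ ∑ _i : Fin 3, ∑ _j : Fin 3, d ^ 2 :=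
    Finset.sum_le_sum fun i _ => Finset.sum_le_sum fun j _ => sq_le _ (hS i j)
  have h3 : ∑ i, (V.2.2.1 i) ^ 2 ≤ ∑ _i : Fin 3, d ^ 2 :=
    Finset.sum_le_sum fun i _ => sq_le _ (hB i)
  have h4 : ∑ i, (V.2.2.2 i) ^ 2 ≤ ∑ _i : Fin 3, d ^ 2 :=
    Finset.sum_le_sum fun i _ => sq_le _ (hE i)
  simp only [Finset.sum_const, Finset.card_univ, Fintype.card_fin, nsmul_eq_mul] at h1 h2 h3 h4
  push_cast at h1 h2 h3 h4
  have hd2 : 0 < d ^ 2 := by positivity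
  unfold stateNorm
  rw [Real.sqrt_lt' (by positivity)]
  nlinarith

lemma relInt_of_magnetic_pair {G : Set MHDState} (hG : GoodClosed G) {u B E b e : V3} {S : Mat3}
    (hbe : dot3 b e = 0) (hne : ¬(B = 0 ∧ E = 0))
    (h1 : ((u, S, B + b, E + e) : MHDState) ∈ relInt G)
    (h2 : ((u, S, B - b, E - e) : MHDState) ∈ relInt G) : ((u, S, B, E) : MHDState) ∈ relInt G := by
  have hs : dot3 ((2 : ℝ) • b) ((2 : ℝ) • e) = 0 := by
    rw [dot3_eq] at hbe ⊢
    simp only [Pi.smul_apply, smul_eq_mul]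
    linear_combination 4 * hbe
  refine relInt_of_ne_zero hG (V := (0, 0, (2 : ℝ) • b, (2 : ℝ) • e)) (lam := 1 / 2)
    (by norm_num) (by norm_num) (mem_WaveCone_of_magnetic hs) hne ?_ ?_
  · convert h1 using 1
    simp [smul_smul]
  · convert h2 using 1
    norm_num [smul_smul]

lemma exists_scale_ne {X : Type*} [AddCommGroup X] [Module ℝ X] {ω : X} (hω : ω ≠ 0) (D : X)
    {M₀ : ℝ} (hM₀ : 0 < M₀) :
    ∃ M : ℝ, M₀ / 2 ≤ M ∧ M ≤ M₀ ∧ ω + M • D ≠ 0 ∧ ω - M • D ≠ 0 := by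
  have half : M₀ • D = (2 : ℝ) • ((M₀ / 2) • D) := by rw [smul_smul]; congr 1; ring
  by_cases h1 : ω + M₀ • D = 0
  · refine ⟨M₀ / 2, le_rfl, by linarith, fun h => hω ?_, fun h => hω ?_⟩
    · rw [half] at h1
      have : ω = (2 : ℝ) • (ω + (M₀ / 2) • D) - (ω + (2 : ℝ) • ((M₀ / 2) • D)) := by module
      rw [this, h, h1]; simp
    · rw [half] at h1
      have : (3 : ℝ) • ω = (2 : ℝ) • (ω - (M₀ / 2) • D) + (ω + (2 : ℝ) • ((M₀ / 2) • D)) := by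
        module
      rw [h, h1] at this
      simpa using this
  by_cases h2 : ω - M₀ • D = 0
  · refine ⟨M₀ / 2, le_rfl, by linarith, fun h => hω ?_, fun h => hω ?_⟩
    · rw [half] at h2
      have : (3 : ℝ) • ω = (2 : ℝ) • (ω + (M₀ / 2) • D) + (ω - (2 : ℝ) • ((M₀ / 2) • D)) := by
        module
      rw [h, h2] at this
      simpa using this
    · rw [half] at h2
      have : ω = (2 : ℝ) • (ω - (M₀ / 2) • D) - (ω - (2 : ℝ) • ((M₀ / 2) • D)) := by module
      rw [this, h, h2]; simp
  exact ⟨M₀, by linarith, le_rfl, h1, h2⟩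

lemma abs_le_one_of_unit {e : V3} (h : dot3 e e = 1) (i : Fin 3) : |e i| ≤ 1 := by
  rw [dot3_eq] at h
  rw [← sq_le_one_iff_abs_le_one]
  have h0 := sq_nonneg (e 0)
  have h1 := sq_nonneg (e 1)
  have h2 := sq_nonneg (e 2)
  fin_cases i
  · change e 0 ^ 2 ≤ 1; linarith
  · change e 1 ^ 2 ≤ 1; linarith
  · change e 2 ^ 2 ≤ 1; linarith

lemma abs_cross3_le {a b : V3} {α β : ℝ} (ha : ∀ i, |a i| ≤ α) (hb : ∀ i, |b i| ≤ β) (i : Fin 3) :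
    |cross3 a b i| ≤ 2 * (α * β) := by
  have hα : 0 ≤ α := (abs_nonneg _).trans (ha 0)
  have key : ∀ j k l m : Fin 3, |a j * b k - a l * b m| ≤ 2 * (α * β) := by
    intro j k l m
    have h1 : |a j * b k| ≤ α * β := by
      rw [abs_mul]; exact mul_le_mul (ha j) (hb k) (abs_nonneg _) hα
    have h2 : |a l * b m| ≤ α * β := by
      rw [abs_mul]; exact mul_le_mul (ha l) (hb m) (abs_nonneg _) hα
    have := abs_sub (a j * b k) (a l * b m)
    linarith
  fin_cases i
  · exact key 1 2 2 1
  · exact key 2 0 0 2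
  · exact key 0 1 1 0

lemma cross3_frame {e B : V3} (he : dot3 e e = 1) (heB : dot3 e B = 0) :
    cross3 e (cross3 B e) = B := by
  rw [dot3_eq] at he heB
  apply V3.ext3 <;> simp only [cross3_zero_apply, cross3_one_apply, cross3_two_apply]
  · linear_combination (B 0) * he - e 0 * heB
  · linear_combination (B 1) * he - e 1 * heB
  · linear_combination (B 2) * he - e 2 * heB

lemma cross3_add_add (v p w q : V3) (a b : ℝ) : cross3 (v + a • p) (w + b • q) =
    cross3 v w + b • cross3 v q + a • (cross3 p w + b • cross3 p q) := by
  apply V3.ext3 <;> simp only [cross3_zero_apply, cross3_one_apply, cross3_two_apply,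
    Pi.add_apply, Pi.smul_apply, smul_eq_mul] <;> ring

lemma relInt_of_opposite {G : Set MHDState} (hG : GoodClosed G) {u₀ B₁ E₁ : V3} {S₀ : Mat3}
    (h1 : ((u₀, S₀, B₁, E₁) : MHDState) ∈ relInt G)
    (h2 : ((u₀, S₀, -B₁, -E₁) : MHDState) ∈ relInt G) :
    ((u₀, S₀, 0, 0) : MHDState) ∈ relInt G := by
  have hBE : dot3 B₁ E₁ = 0 := h1.1.2
  refine ⟨⟨h1.1.1, dot3_zero_left 0⟩, ?_⟩
  obtain ⟨δ₁, hδ₁, hn₁⟩ := mem_nhdsWithin_iff_stateNorm.mp (relInt_mem_nhdsWithin h1)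
  obtain ⟨δ₂, hδ₂, hn₂⟩ := mem_nhdsWithin_iff_stateNorm.mp (relInt_mem_nhdsWithin h2)
  obtain ⟨d, hd, hd1, hd2⟩ : ∃ d : ℝ, 0 < d ∧ 5 * d ≤ δ₁ ∧ 5 * d ≤ δ₂ :=
    ⟨min δ₁ δ₂ / 5, by positivity, by linarith [min_le_left δ₁ δ₂],
      by linarith [min_le_right δ₁ δ₂]⟩
  obtain ⟨κ₁, p, hp, hpB, hE₁⟩ := exists_unit_frame hBE
  set q := cross3 B₁ p with hq
  have hpq : cross3 p q = B₁ := cross3_frame hp hpB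
  obtain ⟨C, hC, hqC, hκC⟩ : ∃ C : ℝ, 0 < C ∧ (∀ i, |q i| ≤ C) ∧ |κ₁| ≤ C := by
    refine ⟨‖q‖ + |κ₁| + 1, by positivity, fun i => ?_, ?_⟩
    · have := norm_le_pi_norm q i
      rw [Real.norm_eq_abs] at this
      linarith [abs_nonneg κ₁]
    · linarith [norm_nonneg q]
  obtain ⟨M₀, hM₀, hM₀d⟩ : ∃ M₀ : ℝ, 0 < M₀ ∧ 2 * (M₀ * C) ≤ d / 2 :=
    ⟨d / (4 * C), by positivity, by apply le_of_eq; field_simp; ring⟩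
  obtain ⟨ρ, hρ, hρd⟩ : ∃ ρ : ℝ, 0 < ρ ∧ ρ * (1 + 8 / M₀) ≤ d / 2 :=
    ⟨d / 2 / (1 + 8 / M₀), by positivity, by apply le_of_eq; field_simp⟩
  have hρd' : ρ ≤ d := by
    have : 0 ≤ ρ * (8 / M₀) := by positivity
    linarith
  -- states with `(u, S)` near `(u₀, S₀)` and two-form near `± (B₁, E₁)`
  have near : ∀ (u : V3) (S : Mat3) (B E : V3), S.IsSymm → dot3 B E = 0 →
      (∀ i, |u i - u₀ i| ≤ d) → (∀ i j, |S i j - S₀ i j| ≤ d) →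
      ((∀ i, |B i - B₁ i| ≤ d) ∧ (∀ i, |E i - E₁ i| ≤ d) ∨
       (∀ i, |B i - -B₁ i| ≤ d) ∧ (∀ i, |E i - -E₁ i| ≤ d)) →
      ((u, S, B, E) : MHDState) ∈ relInt G := by
    rintro u S B E hS hdot hu hSd (⟨hB, hE⟩ | ⟨hB, hE⟩)
    · exact hn₁ _ ⟨hS, hdot⟩ ((stateNorm_lt hd hu hSd hB hE).trans_le hd1)
    · exact hn₂ _ ⟨hS, hdot⟩ ((stateNorm_lt hd hu hSd hB hE).trans_le hd2)
  refine mem_nhdsWithin_iff_stateNorm.mpr ⟨ρ, hρ, ?_⟩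
  rintro ⟨u, S, B, E⟩ ⟨hS, hdot⟩ hnorm
  dsimp only at hS hdot
  have hu : ∀ i, |u i - u₀ i| ≤ d := fun i =>
    (abs_u_le_stateNorm ((u, S, B, E) - (u₀, S₀, 0, 0)) i).trans (hnorm.le.trans hρd')
  have hSd : ∀ i j, |S i j - S₀ i j| ≤ d := fun i j =>
    (abs_S_le_stateNorm ((u, S, B, E) - (u₀, S₀, 0, 0)) i j).trans (hnorm.le.trans hρd')
  have hBρ : ∀ i, |B i| ≤ ρ := fun i => by
    simpa using (abs_B_le_stateNorm ((u, S, B, E) - (u₀, S₀, 0, 0)) i).trans hnorm.le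
  have hEρ : ∀ i, |E i| ≤ ρ := fun i => by
    simpa using (abs_E_le_stateNorm ((u, S, B, E) - (u₀, S₀, 0, 0)) i).trans hnorm.le
  by_cases h0 : B = 0 ∧ E = 0
  · obtain ⟨rfl, rfl⟩ := h0
    have hs : dot3 ((2 : ℝ) • B₁) ((2 : ℝ) • E₁) = 0 := by
      rw [dot3_eq] at hBE ⊢
      simp only [Pi.smul_apply, smul_eq_mul]
      linear_combination 4 * hBE
    have hV := mem_WaveCone_of_magnetic hs
    obtain ⟨ξx, ξt, hξ, hann⟩ := hV.2
    have hW : ((u, S, 0, 0) : MHDState) ∈ MSet := ⟨hS, hdot⟩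
    refine hG (u, S, 0, 0) (0, 0, (2 : ℝ) • B₁, (2 : ℝ) • E₁) (1 / 2) ⟨hW, hV, by norm_num,
      by norm_num, fun t _ _ => line_mem_MSet hW hV.1 ?_ hs t, ξx, ξt, hξ, hann,
      Or.inr (Or.inr (Or.inr ⟨rfl, rfl, rfl, rfl⟩))⟩ (relInt_subset G ?_) (relInt_subset G ?_)
    · rw [dot3_zero_left, dot3_zero_right, add_zero]
    · convert near u S B₁ E₁ hS hBE hu hSd (Or.inl (by simp [hd.le])) using 1
      simp [smul_smul]
    · convert near u S (-B₁) (-E₁) hS (by rw [dot3_eq] at hBE ⊢; simpa using hBE) hu hSd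
        (Or.inr (by simp [hd.le])) using 1
      norm_num [smul_smul]
  obtain ⟨κ, v, hv, hvB, hE⟩ := exists_unit_frame hdot
  set w := cross3 B v with hw
  have hvw : cross3 v w = B := cross3_frame hv hvB
  have hv1 := abs_le_one_of_unit hv
  have hp1 := abs_le_one_of_unit hp
  have hwρ : ∀ i, |w i| ≤ 2 * ρ := fun i => by
    simpa using abs_cross3_le hBρ hv1 i
  have hκρ : |κ| ≤ 3 * ρ := by
    have e1 : κ = E 0 * v 0 + E 1 * v 1 + E 2 * v 2 := by
      rw [dot3_eq] at hv
      simp only [hE, Pi.smul_apply, smul_eq_mul]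
      linear_combination (-κ) * hv
    have e2 : ∀ i, |E i * v i| ≤ ρ := fun i => by
      rw [abs_mul]
      simpa using mul_le_mul (hEρ i) (hv1 i) (abs_nonneg _) hρ.le
    rw [e1]
    have := abs_add_three (E 0 * v 0) (E 1 * v 1) (E 2 * v 2)
    linarith [e2 0, e2 1, e2 2]
  obtain ⟨M, hM1, hM2, hMp, hMm⟩ := exists_scale_ne (ω := (B, E)) (by simpa using h0)
    (cross3 v q, κ₁ • v) hM₀
  have hM : 0 < M := by linarith
  have hMinv : M⁻¹ ≤ 2 / M₀ := by
    rw [inv_le_comm₀ hM (by positivity)]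
    simpa using hM1
  have hMC : M * C ≤ M₀ * C := by gcongr
  have hNρ : M⁻¹ * ρ ≤ 2 / M₀ * ρ := by gcongr
  have hρd2 : ρ + 4 * (2 / M₀ * ρ) ≤ d / 2 := by
    have : ρ * (1 + 8 / M₀) = ρ + 4 * (2 / M₀ * ρ) := by ring
    linarith
  have bound : ∀ σ τ : ℝ, |σ| = 1 → |τ| = 1 →
      (∀ i, |cross3 (v + (σ * M⁻¹) • p) (w + (τ * M) • q) i - σ * τ * B₁ i| ≤ d) ∧
      (∀ i, |((κ + τ * M * κ₁) • (v + (σ * M⁻¹) • p)) i - σ * τ * E₁ i| ≤ d) := by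
    intro σ τ hσ hτ
    have hN : |σ * M⁻¹| = M⁻¹ := by rw [abs_mul, hσ, one_mul, abs_of_pos (inv_pos.mpr hM)]
    have hT : |τ * M| = M := by rw [abs_mul, hτ, one_mul, abs_of_pos hM]
    constructor <;> intro i
    · rw [cross3_add_add, hvw, hpq]
      have e : (B + (τ * M) • cross3 v q + (σ * M⁻¹) • (cross3 p w + (τ * M) • B₁)) i
          - σ * τ * B₁ i = B i + (τ * M) * cross3 v q i + (σ * M⁻¹) * cross3 p w i := by
        simp only [Pi.add_apply, Pi.smul_apply, smul_eq_mul]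
        field_simp
        ring
      rw [e]
      refine (abs_add_three _ _ _).trans ?_
      rw [abs_mul (τ * M), abs_mul (σ * M⁻¹), hN, hT]
      have b1 := mul_le_mul_of_nonneg_left (abs_cross3_le hv1 hqC i) hM.le
      have b2 := mul_le_mul_of_nonneg_left (abs_cross3_le hp1 hwρ i) (inv_pos.mpr hM).le
      linarith [hBρ i]
    · have e : ((κ + τ * M * κ₁) • (v + (σ * M⁻¹) • p)) i - σ * τ * E₁ i
          = E i + (τ * M) * (κ₁ * v i) + (σ * M⁻¹) * (κ * p i) := by
        simp only [hE, hE₁, Pi.add_apply, Pi.smul_apply, smul_eq_mul]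
        field_simp
        ring
      rw [e]
      refine (abs_add_three _ _ _).trans ?_
      rw [abs_mul (τ * M), abs_mul (σ * M⁻¹), hN, hT, abs_mul κ₁, abs_mul κ]
      have b1 : M * (|κ₁| * |v i|) ≤ M * (C * 1) := by gcongr; exact hv1 i
      have b2 : M⁻¹ * (|κ| * |p i|) ≤ M⁻¹ * (3 * ρ * 1) := by gcongr; exact hp1 i
      have : 0 ≤ M * C := by positivity
      have : 0 ≤ M⁻¹ * ρ := by positivity
      linarith [hEρ i]
  have corner : ∀ σ τ : ℝ, |σ| = 1 → |τ| = 1 → ((u, S, cross3 (v + (σ * M⁻¹) • p) (w + (τ * M) • q),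
      (κ + τ * M * κ₁) • (v + (σ * M⁻¹) • p)) : MHDState) ∈ relInt G := by
    intro σ τ hσ hτ
    have hb := bound σ τ hσ hτ
    have hst : |σ * τ| = 1 := by rw [abs_mul, hσ, hτ, one_mul]
    refine near u S _ _ hS ?_ hu hSd ?_
    · simpa using dot3_wedge_self (v + (σ * M⁻¹) • p) (w + (τ * M) • q) 0 (κ + τ * M * κ₁)
    · rcases eq_or_eq_neg_of_abs_eq hst with h | h <;> rw [h] at hb
      · exact Or.inl (by simpa using hb)
      · exact Or.inr (by simpa using hb)
  have edge : ∀ τ : ℝ, |τ| = 1 → ¬(B + (τ * M) • cross3 v q = 0 ∧ E + (τ * M) • (κ₁ • v) = 0) →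
      ((u, S, B + (τ * M) • cross3 v q, E + (τ * M) • (κ₁ • v)) : MHDState) ∈ relInt G := by
    intro τ hτ hne
    refine relInt_of_magnetic_pair hG (b := M⁻¹ • cross3 p (w + (τ * M) • q))
      (e := M⁻¹ • (κ + τ * M * κ₁) • p) ?_ hne ?_ ?_
    · have := dot3_wedge_self p (w + (τ * M) • q) 0 (κ + τ * M * κ₁)
      simp only [zero_smul, sub_zero] at this
      rw [dot3_eq] at this ⊢
      simp only [Pi.smul_apply, smul_eq_mul] at this ⊢
      linear_combination (M⁻¹ * M⁻¹) * this
    · convert corner 1 τ (by simp) hτ using 4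
      · rw [← hvw]
        apply V3.ext3 <;> simp only [cross3_zero_apply, cross3_one_apply, cross3_two_apply,
          Pi.add_apply, Pi.smul_apply, smul_eq_mul] <;> ring
      · rw [hE]; module
    · convert corner (-1) τ (by simp) hτ using 4
      · rw [← hvw]
        apply V3.ext3 <;> simp only [cross3_zero_apply, cross3_one_apply, cross3_two_apply,
          Pi.add_apply, Pi.sub_apply, Pi.smul_apply, smul_eq_mul] <;> ring
      · rw [hE]; module
  refine relInt_subset G (relInt_of_magnetic_pair hG (b := M • cross3 v q) (e := M • κ₁ • v)
    ?_ h0 ?_ ?_)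
  · have := dot3_wedge_self v q 0 κ₁
    simp only [zero_smul, sub_zero] at this
    rw [dot3_eq] at this ⊢
    simp only [Pi.smul_apply, smul_eq_mul] at this ⊢
    linear_combination (M * M) * this
  · have := edge 1 (by simp) (by simpa [Prod.ext_iff] using hMp)
    simpa using this
  · have := edge (-1) (by simp) (by simpa [Prod.ext_iff, sub_eq_add_neg] using hMm)
    simpa [sub_eq_add_neg] using this

/-- The relative interior of a set closed under good segments is closed under all
`Λ`-segments. -/
lemma relInt_of_segment {G : Set MHDState} (hG : GoodClosed G) {V₀ V : MHDState} {lam : ℝ}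
    (hl0 : 0 < lam) (hl1 : lam < 1) (hV : V ∈ WaveCone)
    (h1 : V₀ + lam • V ∈ relInt G) (h2 : V₀ - (1 - lam) • V ∈ relInt G) : V₀ ∈ relInt G := by
  by_cases hne : V₀.2.2.1 = 0 ∧ V₀.2.2.2 = 0
  swap
  · exact relInt_of_ne_zero hG hl0 hl1 hV hne h1 h2
  by_cases hω : V.2.2.1 = 0 ∧ V.2.2.2 = 0
  · exact relInt_of_hydrodynamic hG hl0 hl1 hV hω.1 hω.2 h1 h2
  obtain ⟨hM, -⟩ := center_mem_MSet hV h1.1 h2.1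
  obtain ⟨u₀, S₀, B₀, E₀⟩ := V₀
  obtain ⟨rfl, rfl⟩ : B₀ = 0 ∧ E₀ = 0 := hne
  obtain ⟨u, S, B, E⟩ := V
  dsimp only at hω
  have hBE : dot3 B E = 0 := waveCone_dot3_eq_zero hV
  rw [sub_eq_add_neg_smul] at h2
  have hscale : ∀ a b : ℝ, dot3 (a • B) (b • E) = 0 := fun a b => by
    rw [dot3_eq] at hBE ⊢
    simp only [Pi.smul_apply, smul_eq_mul]
    linear_combination (a * b) * hBE
  have shift : ∀ t : ℝ, ((u₀, S₀, 0, 0) + t • (u, S, B, E) : MHDState) ∈ relInt G →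
      ∀ᶠ η in 𝓝 (0 : ℝ), ((u₀, S₀, η • B, η • E) + t • (u, S, B, E) : MHDState) ∈ relInt G := by
    intro t ht
    refine eventually_mem_relInt ht ?_ (Eventually.of_forall fun η => ?_)
    · have : Continuous fun η : ℝ => ((u₀, S₀, η • B, η • E) + t • (u, S, B, E) : MHDState) := by
        fun_prop
      simpa using this.tendsto 0
    · refine line_mem_MSet (W := (u₀, S₀, η • B, η • E)) ⟨hM.1, hscale η η⟩ hV.1 ?_ hBE t
      have e1 := hscale η 1
      have e2 := hscale 1 η
      rw [one_smul] at e1 e2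
      change dot3 (η • B) E + dot3 B (η • E) = 0
      rw [e1, e2, add_zero]
  have centre : ∀ᶠ η in 𝓝[≠] (0 : ℝ), ((u₀, S₀, η • B, η • E) : MHDState) ∈ relInt G := by
    filter_upwards [nhdsWithin_le_nhds (shift _ h1), nhdsWithin_le_nhds (shift _ h2),
      self_mem_nhdsWithin] with η hp hm hη
    refine relInt_of_ne_zero hG hl0 hl1 hV (fun h => hω ?_) hp
      (by rw [sub_eq_add_neg_smul]; exact hm)
    exact ⟨(smul_eq_zero.mp h.1).resolve_left hη, (smul_eq_zero.mp h.2).resolve_left hη⟩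
  have centre' : ∀ᶠ η in 𝓝[≠] (0 : ℝ), ((u₀, S₀, (-η) • B, (-η) • E) : MHDState) ∈ relInt G := by
    have : Tendsto (fun η : ℝ => -η) (𝓝[≠] 0) (𝓝[≠] 0) := by
      refine tendsto_nhdsWithin_iff.mpr ⟨?_, ?_⟩
      · simpa using ((continuous_neg (G := ℝ)).tendsto 0).mono_left nhdsWithin_le_nhds
      · filter_upwards [self_mem_nhdsWithin] with η hη
        simpa using hη
    exact this.eventually centre
  obtain ⟨η, hp, hm⟩ := (centre.and centre').exists
  exact relInt_of_opposite hG hp (by simpa using hm)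

/-! ### Hulls -/

lemma lamHull_mono (Y : Set MHDState) : Monotone (lamHull Y) :=
  monotone_nat_of_le_succ fun _ => Set.subset_union_left

lemma lamHullG_mono (Y : Set MHDState) : Monotone (lamHullG Y) :=
  monotone_nat_of_le_succ fun _ => Set.subset_union_left

lemma subset_lcHull (Y : Set MHDState) : Y ⊆ lcHull Y := Set.subset_iUnion (lamHull Y) 0

lemma subset_lcHullG (Y : Set MHDState) : Y ⊆ lcHullG Y := Set.subset_iUnion (lamHullG Y) 0

lemma lcHull_segment {Y : Set MHDState} {V W : MHDState} {lam : ℝ} (h0 : 0 ≤ lam) (h1 : lam ≤ 1)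
    (hV : V ∈ lcHull Y) (hW : W ∈ lcHull Y) (hVW : V - W ∈ WaveCone) :
    lam • V + (1 - lam) • W ∈ lcHull Y := by
  obtain ⟨i, hi⟩ := Set.mem_iUnion.mp hV
  obtain ⟨j, hj⟩ := Set.mem_iUnion.mp hW
  exact Set.mem_iUnion.mpr ⟨max i j + 1, Or.inr ⟨lam, V, W, h0, h1,
    lamHull_mono Y (le_max_left i j) hi, lamHull_mono Y (le_max_right i j) hj, hVW, rfl⟩⟩

lemma lcHull_induction {Y T : Set MHDState} (hY : Y ⊆ T)
    (hT : ∀ (lam : ℝ) (V W : MHDState), 0 ≤ lam → lam ≤ 1 → V ∈ T → W ∈ T → V - W ∈ WaveCone →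
      lam • V + (1 - lam) • W ∈ T) : lcHull Y ⊆ T := by
  refine Set.iUnion_subset fun N => ?_
  induction N with
  | zero => exact hY
  | succ N ih =>
    rintro Z (hZ | ⟨lam, V, W, h0, h1, hV, hW, hVW, rfl⟩)
    · exact ih hZ
    · exact hT lam V W h0 h1 (ih hV) (ih hW) hVW

lemma goodClosed_lcHullG (Y : Set MHDState) : GoodClosed (lcHullG Y) := by
  intro V₀ V lam h h1 h2
  obtain ⟨i, hi⟩ := Set.mem_iUnion.mp h1
  obtain ⟨j, hj⟩ := Set.mem_iUnion.mp h2
  exact Set.mem_iUnion.mpr ⟨max i j + 1, Or.inr ⟨lam, V, h,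
    lamHullG_mono Y (le_max_left i j) hi, lamHullG_mono Y (le_max_right i j) hj⟩⟩

lemma lcHullG_subset_lcHull (Y : Set MHDState) : lcHullG Y ⊆ lcHull Y := by
  refine Set.iUnion_subset fun N => ?_
  induction N with
  | zero => exact subset_lcHull Y
  | succ N ih =>
    rintro V₀ (hZ | ⟨lam, V, h, h1, h2⟩)
    · exact ih hZ
    · have hd : (V₀ + lam • V) - (V₀ - (1 - lam) • V) = V := by module
      have := lcHull_segment (lam := 1 - lam) (by linarith [h.2.2.2.1]) (by linarith [h.2.2.1])
        (ih h1) (ih h2) (by rw [hd]; exact h.2.1)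
      convert this using 1
      module

/-- The good hull of a relatively open set is relatively open and equals its `Λ`-hull. -/
lemma lcHull_subset_relInt {O : Set MHDState} (hM : O ⊆ MSet) (hO : ∀ V ∈ O, O ∈ 𝓝[MSet] V) :
    lcHull O ⊆ relInt (lcHullG O) := by
  refine lcHull_induction
    (fun V hV => ⟨hM hV, mem_of_superset (hO V hV) (subset_lcHullG O)⟩) ?_
  intro lam V W h0 h1 hV hW hVW
  rcases h0.eq_or_lt with rfl | h0
  · simpa using hW
  rcases h1.eq_or_lt with rfl | h1
  · simpa using hV
  refine relInt_of_segment (goodClosed_lcHullG O) (lam := 1 - lam) (by linarith) (by linarith)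
    hVW ?_ ?_
  · convert hV using 1; module
  · convert hW using 1; module

lemma lcHullG_subset_Uset {O : Set MHDState} {r s : ℝ} (hM : O ⊆ MSet)
    (hO : ∀ V ∈ O, O ∈ 𝓝[MSet] V) (h : O ⊆ lcHull (Kset r s)) : lcHullG O ⊆ Uset r s := by
  intro V hV
  obtain ⟨hVM, hn⟩ := lcHull_subset_relInt hM hO (lcHullG_subset_lcHull O hV)
  have hsub : lcHullG O ⊆ lcHull (Kset r s) := (lcHullG_subset_lcHull O).trans
    (lcHull_induction h fun lam V W h0 h1 => lcHull_segment h0 h1)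
  exact ⟨hVM, mem_nhdsWithin_iff_stateNorm.mp (mem_of_superset hn hsub)⟩

lemma lcHull_subset_lcHullG {K O : Set MHDState} (hM : O ⊆ MSet) (hO : ∀ V ∈ O, O ∈ 𝓝[MSet] V)
    (h : K ⊆ O) : lcHull K ⊆ lcHullG O :=
  (lcHull_induction (h.trans (subset_lcHull O)) fun _ _ _ h0 h1 => lcHull_segment h0 h1).trans
    ((lcHull_subset_relInt hM hO).trans (relInt_subset _))

/-! ### Scaling -/

/-- The parabolic rescaling `(u, S, B, E) ↦ (τ u, τ² S, τ B, τ² E)`. -/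
def rescale (τ : ℝ) (V : MHDState) : MHDState :=
  (τ • V.1, τ ^ 2 • V.2.1, τ • V.2.2.1, τ ^ 2 • V.2.2.2)

lemma eNorm3_eq (a : V3) : eNorm3 a = Real.sqrt (dot3 a a) := by
  simp [eNorm3, dot3, sq]

lemma eNorm3_smul (c : ℝ) (a : V3) : eNorm3 (c • a) = |c| * eNorm3 a := by
  have : dot3 (c • a) (c • a) = c ^ 2 * dot3 a a := by
    simp only [dot3_eq, Pi.smul_apply, smul_eq_mul]; ring
  rw [eNorm3_eq, eNorm3_eq, this, Real.sqrt_mul (sq_nonneg c), Real.sqrt_sq_eq_abs]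

lemma rescale_mem_WaveCone {τ : ℝ} {V : MHDState} (h : V ∈ WaveCone) : rescale τ V ∈ WaveCone := by
  obtain ⟨hS, ξx, ξt, hξ, h1, h2, h3, h4⟩ := h
  refine ⟨hS.smul _, ξx, τ * ξt, hξ, ?_, ?_, ?_, ?_⟩
  · rw [dot3_eq] at h1 ⊢
    simp only [rescale, Pi.smul_apply, smul_eq_mul]
    linear_combination τ * h1
  · rw [dot3_eq] at h2 ⊢
    simp only [rescale, Pi.smul_apply, smul_eq_mul]
    linear_combination τ * h2
  · have : (τ * ξt) • τ • V.1 + (τ ^ 2 • V.2.1).mulVec ξx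
        = τ ^ 2 • (ξt • V.1 + V.2.1.mulVec ξx) := by
      rw [Matrix.smul_mulVec]; module
    exact this.trans (by rw [h3, smul_zero])
  · have : (τ * ξt) • τ • V.2.2.1 + cross3 ξx (τ ^ 2 • V.2.2.2)
        = τ ^ 2 • (ξt • V.2.2.1 + cross3 ξx V.2.2.2) := by
      apply V3.ext3 <;> simp only [cross3_zero_apply, cross3_one_apply, cross3_two_apply,
        Pi.smul_apply, Pi.add_apply, smul_eq_mul] <;> ring
    exact this.trans (by rw [h4, smul_zero])

lemma rescale_mem_Kset {τ r s : ℝ} (hτ : 0 < τ) {V : MHDState} (h : V ∈ Kset r s) :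
    rescale τ V ∈ Kset (τ * r) (τ * s) := by
  obtain ⟨q, hq, hS, hE, hr, hs⟩ := h
  refine ⟨τ ^ 2 * q, ?_, ?_, ?_, ?_, ?_⟩
  · rw [abs_mul, abs_of_nonneg (sq_nonneg τ)]
    nlinarith [sq_nonneg τ]
  · ext i j
    simp only [rescale, hS, Matrix.smul_apply, Matrix.add_apply, Matrix.sub_apply, outer_apply,
      Pi.smul_apply, smul_eq_mul]
    ring
  · simp only [rescale, hE]
    apply V3.ext3 <;> simp only [cross3_zero_apply, cross3_one_apply, cross3_two_apply,
      Pi.smul_apply, smul_eq_mul] <;> ring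
  · simp only [rescale]
    rw [← smul_add, eNorm3_smul, hr, abs_of_pos hτ]
  · simp only [rescale]
    rw [← smul_sub, eNorm3_smul, hs, abs_of_pos hτ]

lemma rescale_sub (τ : ℝ) (V W : MHDState) : rescale τ (V - W) = rescale τ V - rescale τ W := by
  simp only [rescale, Prod.fst_sub, Prod.snd_sub, smul_sub, Prod.mk_sub_mk]

lemma rescale_comb (τ a b : ℝ) (V W : MHDState) :
    rescale τ (a • V + b • W) = a • rescale τ V + b • rescale τ W := by
  simp only [rescale, Prod.fst_add, Prod.snd_add, Prod.smul_fst, Prod.smul_snd, Prod.smul_mk,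
    Prod.mk_add_mk, smul_add, smul_comm τ, smul_comm (τ ^ 2)]

lemma rescale_mem_lcHull {τ r s : ℝ} (hτ : 0 < τ) {V : MHDState} (h : V ∈ lcHull (Kset r s)) :
    rescale τ V ∈ lcHull (Kset (τ * r) (τ * s)) := by
  have : lcHull (Kset r s) ⊆ {V | rescale τ V ∈ lcHull (Kset (τ * r) (τ * s))} := by
    refine lcHull_induction (fun V hV => subset_lcHull _ (rescale_mem_Kset hτ hV)) ?_
    intro lam V W h0 h1 hV hW hVW
    simp only [Set.mem_ofPred_eq, rescale_comb]
    exact lcHull_segment h0 h1 hV hW (by rw [← rescale_sub]; exact rescale_mem_WaveCone hVW)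
  exact this h

lemma Uset_subset_iUnion (r s : ℝ) {τ₀ : ℝ} (hτ₀ : τ₀ ∈ Set.Ioo (0 : ℝ) 1) :
    Uset r s ⊆ ⋃ τ ∈ Set.Ioo τ₀ 1, lcHull (Kset (τ * r) (τ * s)) := by
  rintro V ⟨hVM, hn⟩
  have hn := mem_nhdsWithin_iff_stateNorm.mpr hn
  have c : ContinuousAt (fun τ : ℝ => rescale τ⁻¹ V) 1 := by
    have c1 : Continuous fun τ : ℝ => rescale τ V := by unfold rescale; fun_prop
    exact c1.continuousAt.comp (continuousAt_inv₀ one_ne_zero)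
  have t : Tendsto (fun τ : ℝ => rescale τ⁻¹ V) (𝓝[<] 1) (𝓝[MSet] V) := by
    refine tendsto_nhdsWithin_iff.mpr ⟨?_, Eventually.of_forall fun τ => ⟨hVM.1.smul _, ?_⟩⟩
    · have e : rescale (1 : ℝ)⁻¹ V = V := by simp [rescale]
      have := c.tendsto
      rw [e] at this
      exact this.mono_left nhdsWithin_le_nhds
    · have := hVM.2
      rw [dot3_eq] at this ⊢
      simp only [rescale, Pi.smul_apply, smul_eq_mul]
      linear_combination (τ⁻¹ * τ⁻¹ ^ 2) * this
  have hev : ∀ᶠ τ in 𝓝[<] (1 : ℝ), τ ∈ Set.Ioo τ₀ 1 := Ioo_mem_nhdsLT hτ₀.2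
  have hmem : ∀ᶠ τ in 𝓝[<] (1 : ℝ), rescale τ⁻¹ V ∈ lcHull (Kset r s) := t hn
  obtain ⟨τ, hτ, hmem⟩ := (hev.and hmem).exists
  have hτ0 : 0 < τ := hτ₀.1.trans hτ.1
  refine Set.mem_biUnion hτ ?_
  have h := rescale_mem_lcHull hτ0 hmem
  convert h using 1
  simp [rescale, smul_smul, hτ0.ne']

/-! ### Perturbations of the constitutive set -/

/-- The state with Elsasser variables `z = u + B`, `w = u - B`, perturbed by `σ` and `e`. -/
def els (z w : V3) (σ : Mat3) (e : V3) : MHDState :=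
  ((1 / 2 : ℝ) • (z + w), (1 / 2 : ℝ) • (outer z w + outer w z) + σ, (1 / 2 : ℝ) • (z - w),
    (1 / 2 : ℝ) • cross3 z w + e)

lemma eNorm3_eq_norm (a : V3) : eNorm3 a = ‖WithLp.toLp 2 a‖ := by
  simp [eNorm3, EuclideanSpace.norm_eq]

lemma eNorm3_add_le (a b : V3) : eNorm3 (a + b) ≤ eNorm3 a + eNorm3 b := by
  simp only [eNorm3_eq_norm, WithLp.toLp_add]
  exact norm_add_le _ _

lemma eNorm3_sub_le (a b : V3) : eNorm3 (a - b) ≤ eNorm3 a + eNorm3 b := by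
  simp only [eNorm3_eq_norm, WithLp.toLp_sub]
  exact norm_sub_le _ _

lemma abs_le_eNorm3 (a : V3) (i : Fin 3) : |a i| ≤ eNorm3 a := by
  rw [← Real.sqrt_sq_eq_abs]
  exact Real.sqrt_le_sqrt
    (Finset.single_le_sum (f := fun i => (a i) ^ 2) (fun i _ => sq_nonneg _) (Finset.mem_univ i))

lemma eNorm3_le_two_mul {a : V3} {d : ℝ} (h : ∀ i, |a i| ≤ d) : eNorm3 a ≤ 2 * d := by
  have hd : 0 ≤ d := (abs_nonneg _).trans (h 0)
  have hi : ∀ i, (a i) ^ 2 ≤ d ^ 2 := fun i => by rw [← sq_abs]; have := h i; gcongr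
  refine Real.sqrt_le_iff.mpr ⟨by positivity, ?_⟩
  rw [Fin.sum_univ_three]
  nlinarith [hi 0, hi 1, hi 2]

lemma abs_le_frobNorm (M : Mat3) (i j : Fin 3) : |M i j| ≤ frobNorm M := by
  rw [← Real.sqrt_sq_eq_abs]
  refine Real.sqrt_le_sqrt ((Finset.single_le_sum (f := fun j => (M i j) ^ 2)
    (fun i _ => sq_nonneg _) (Finset.mem_univ j)).trans ?_)
  exact Finset.single_le_sum (f := fun i => ∑ j, (M i j) ^ 2)
    (fun i _ => Finset.sum_nonneg fun j _ => sq_nonneg _) (Finset.mem_univ i)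

lemma frobNorm_le_three_mul {M : Mat3} {d : ℝ} (h : ∀ i j, |M i j| ≤ d) :
    frobNorm M ≤ 3 * d := by
  have hd : 0 ≤ d := (abs_nonneg _).trans (h 0 0)
  have hi : ∀ i j, (M i j) ^ 2 ≤ d ^ 2 := fun i j => by rw [← sq_abs]; have := h i j; gcongr
  refine Real.sqrt_le_iff.mpr ⟨by positivity, ?_⟩
  simp only [Fin.sum_univ_three]
  nlinarith [hi 0 0, hi 0 1, hi 0 2, hi 1 0, hi 1 1, hi 1 2, hi 2 0, hi 2 1, hi 2 2]

lemma els_add_mem {Y : Set MHDState} {z w p q ξ e : V3} {σ : Mat3} {ξt : ℝ} (hξ : ξ ≠ 0)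
    (hp : dot3 ξ p = 0) (hq : dot3 ξ q = 0) (hpw : (ξt + dot3 ξ w) • p = 0)
    (hqz : (ξt + dot3 ξ z) • q = 0)
    (h1 : els (z + p) (w + q) σ e ∈ lcHull Y) (h2 : els (z - p) (w - q) σ e ∈ lcHull Y) :
    els z w (σ + (1 / 2 : ℝ) • (outer p q + outer q p)) (e + (1 / 2 : ℝ) • cross3 p q)
      ∈ lcHull Y := by
  have key := lcHull_segment (lam := 1 / 2) (by norm_num) (by norm_num) h1 h2 ?_
  · convert key using 1
    refine Prod.ext ?_ (Prod.ext ?_ (Prod.ext ?_ ?_))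
    · simp only [els, Prod.fst_add, Prod.smul_fst]
      module
    · ext i j
      simp only [els, Prod.fst_add, Prod.snd_add, Prod.smul_fst, Prod.smul_snd,
        Matrix.add_apply, Matrix.smul_apply, outer_apply, Pi.add_apply, Pi.sub_apply, smul_eq_mul]
      ring
    · simp only [els, Prod.fst_add, Prod.snd_add, Prod.smul_fst, Prod.smul_snd]
      module
    · apply V3.ext3 <;> simp only [els, Prod.snd_add, Prod.smul_snd, cross3_zero_apply,
        cross3_one_apply, cross3_two_apply, Pi.add_apply, Pi.sub_apply, Pi.smul_apply,
        smul_eq_mul] <;> ring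
  · have hpi : ∀ i, (ξt + dot3 ξ w) * p i = 0 := fun i => congrFun hpw i
    have hqi : ∀ i, (ξt + dot3 ξ z) * q i = 0 := fun i => congrFun hqz i
    refine ⟨?_, ξ, ξt, hξ, ?_, ?_, ?_, ?_⟩
    · ext i j
      simp only [els, Prod.fst_sub, Prod.snd_sub, Matrix.transpose_apply,
        Matrix.sub_apply, Matrix.add_apply, Matrix.smul_apply, outer_apply, Pi.add_apply,
        Pi.sub_apply, smul_eq_mul]
      ring
    · rw [dot3_eq] at hp hq ⊢
      simp only [els, Prod.fst_sub, Pi.add_apply, Pi.sub_apply, Pi.smul_apply, smul_eq_mul]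
      linear_combination hp + hq
    · rw [dot3_eq] at hp hq ⊢
      simp only [els, Prod.fst_sub, Prod.snd_sub, Pi.add_apply, Pi.sub_apply, Pi.smul_apply,
        smul_eq_mul]
      linear_combination hp - hq
    · simp only [dot3_eq] at hp hq hpi hqi
      funext i
      simp only [els, Prod.fst_sub, Prod.snd_sub, mulVec3_apply, Matrix.sub_apply,
        Matrix.add_apply, Matrix.smul_apply, outer_apply, Pi.add_apply, Pi.sub_apply,
        Pi.smul_apply, smul_eq_mul, Pi.zero_apply]
      linear_combination hpi i + hqi i + (z i) * hq + (w i) * hp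
    · simp only [dot3_eq] at hp hq hpi hqi
      apply V3.ext3 <;> simp only [els, Prod.fst_sub, Prod.snd_sub, cross3_zero_apply,
        cross3_one_apply, cross3_two_apply, Pi.add_apply, Pi.sub_apply, Pi.smul_apply,
        smul_eq_mul, Pi.zero_apply]
      · linear_combination hpi 0 - hqi 0 + (z 0) * hq - (w 0) * hp
      · linear_combination hpi 1 - hqi 1 + (z 1) * hq - (w 1) * hp
      · linear_combination hpi 2 - hqi 2 + (z 2) * hq - (w 2) * hp

lemma els_mem_Kset {z w : V3} {κ : ℝ} (h : |κ| ≤ eNorm3 z * eNorm3 w) :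
    els z w (κ • (1 : Mat3)) 0 ∈ Kset (eNorm3 z) (eNorm3 w) := by
  refine ⟨κ, h, ?_, ?_, ?_, ?_⟩
  · ext i j
    simp only [els, Matrix.add_apply, Matrix.sub_apply, Matrix.smul_apply, outer_apply,
      Pi.add_apply, Pi.sub_apply, Pi.smul_apply, smul_eq_mul]
    ring
  · apply V3.ext3 <;> simp only [els, cross3_zero_apply, cross3_one_apply, cross3_two_apply,
      Pi.add_apply, Pi.sub_apply, Pi.smul_apply, smul_eq_mul, Pi.zero_apply] <;> ring
  · congr 1
    simp only [els]
    module
  · congr 1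
    simp only [els]
    module

/-- A vector in a ball is the midpoint of two points on the sphere. -/
lemma exists_eNorm3_eq {z : V3} {r : ℝ} (h : eNorm3 z ≤ r) :
    ∃ p : V3, eNorm3 (z + p) = r ∧ eNorm3 (z - p) = r := by
  obtain ⟨e, he, hez⟩ := exists_unit_perp z
  have hr : 0 ≤ r := (Real.sqrt_nonneg _).trans h
  have hz : dot3 z z ≤ r ^ 2 := by
    rw [eNorm3_eq] at h
    exact (Real.sqrt_le_iff.mp h).2
  have hs := Real.sq_sqrt (sub_nonneg.mpr hz)
  refine ⟨Real.sqrt (r ^ 2 - dot3 z z) • e, ?_, ?_⟩ <;>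
  · rw [eNorm3_eq]
    refine (congrArg Real.sqrt ?_).trans (Real.sqrt_sq hr)
    generalize Real.sqrt (r ^ 2 - dot3 z z) = ρ at hs
    rw [dot3_eq] at he hez hs ⊢
    simp only [Pi.add_apply, Pi.sub_apply, Pi.smul_apply, smul_eq_mul]
    first
      | linear_combination hs + ρ ^ 2 * he + 2 * ρ * hez
      | linear_combination hs + ρ ^ 2 * he - 2 * ρ * hez

lemma els_scalar_mem {r s κ : ℝ} (hκ : |κ| ≤ r * s) {z w : V3} (hz : eNorm3 z ≤ r)
    (hw : eNorm3 w ≤ s) : els z w (κ • (1 : Mat3)) 0 ∈ lcHull (Kset r s) := by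
  have base : ∀ z w : V3, eNorm3 z = r → eNorm3 w = s →
      els z w (κ • (1 : Mat3)) 0 ∈ lcHull (Kset r s) := by
    rintro z w rfl rfl
    exact subset_lcHull _ (els_mem_Kset hκ)
  have o1 : ∀ a : V3, outer a 0 = 0 := fun a => by ext; simp
  have o2 : ∀ a : V3, outer 0 a = 0 := fun a => by ext; simp
  have c1 : ∀ a : V3, cross3 a 0 = 0 := fun a => by apply V3.ext3 <;> simp
  have c2 : ∀ a : V3, cross3 0 a = 0 := fun a => by apply V3.ext3 <;> simp
  have half : ∀ w : V3, eNorm3 w = s → els z w (κ • (1 : Mat3)) 0 ∈ lcHull (Kset r s) := by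
    intro w hw
    obtain ⟨p, hp1, hp2⟩ := exists_eNorm3_eq hz
    obtain ⟨ξ, hξ, hξp, -⟩ := exists_perp₂ p p
    have := els_add_mem (z := z) (w := w) (q := 0) (ξt := -dot3 ξ w) hξ hξp (dot3_zero_right ξ)
      (by simp) (by simp) (base _ _ hp1 (by simpa using hw)) (base _ _ hp2 (by simpa using hw))
    simpa [o1, o2, c1] using this
  obtain ⟨q, hq1, hq2⟩ := exists_eNorm3_eq hw
  obtain ⟨ξ, hξ, hξq, -⟩ := exists_perp₂ q q
  have := els_add_mem (z := z) (w := w) (p := 0) (ξt := -dot3 ξ z) hξ (dot3_zero_right ξ) hξq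
    (by simp) (by simp) (by simpa using half _ hq1) (by simpa using half _ hq2)
  simpa [o1, o2, c2] using this

lemma els_rank_one_mem {Y : Set MHDState} {R R' m κ : ℝ} {σ : Mat3} {f : V3}
    (h : ∀ z w : V3, eNorm3 z ≤ R → eNorm3 w ≤ R' → els z w σ 0 ∈ lcHull Y)
    (hf : eNorm3 f ≤ 2) (hm : 0 < m) (hκ : |κ| ≤ m ^ 2) (z w : V3) (hz : eNorm3 z ≤ R - 2 * m)
    (hw : eNorm3 w ≤ R' - 2 * m) : els z w (σ + κ • outer f f) 0 ∈ lcHull Y := by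
  obtain ⟨ξ, hξ, hξf, hξzw⟩ := exists_perp₂ f (z - w)
  have hzw : dot3 ξ z = dot3 ξ w := by
    rw [dot3_eq] at hξzw
    simp only [dot3_eq]
    simp only [Pi.sub_apply] at hξzw
    linear_combination hξzw
  have hsm : ∀ a : ℝ, dot3 ξ (a • f) = 0 := fun a => by
    rw [dot3_eq] at hξf ⊢
    simp only [Pi.smul_apply, smul_eq_mul]
    linear_combination a * hξf
  have hp : eNorm3 (m • f) ≤ 2 * m := by
    rw [eNorm3_smul, abs_of_pos hm]; nlinarith
  have hq : eNorm3 ((κ / m) • f) ≤ 2 * m := by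
    have : |κ / m| ≤ m := by
      rw [abs_div, abs_of_pos hm, div_le_iff₀ hm]; nlinarith
    rw [eNorm3_smul]
    have h0 : 0 ≤ eNorm3 f := Real.sqrt_nonneg _
    nlinarith
  have := els_add_mem (z := z) (w := w) (p := m • f) (q := (κ / m) • f) (σ := σ) (e := 0)
    (ξt := -dot3 ξ w) hξ (hsm _) (hsm _) (by simp) (by simp [hzw])
    (h _ _ ((eNorm3_add_le _ _).trans (by linarith)) ((eNorm3_add_le _ _).trans (by linarith)))
    (h _ _ ((eNorm3_sub_le _ _).trans (by linarith)) ((eNorm3_sub_le _ _).trans (by linarith)))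
  convert this using 2
  · ext i j
    simp only [Matrix.add_apply, Matrix.smul_apply, outer_apply, Pi.smul_apply, smul_eq_mul]
    field_simp
    ring
  · apply V3.ext3 <;> simp only [cross3_zero_apply, cross3_one_apply, cross3_two_apply,
      Pi.add_apply, Pi.smul_apply, smul_eq_mul, Pi.zero_apply] <;> ring

lemma els_symm_mem {r s m κ : ℝ} {σ : Mat3} (hm : 0 < m) (hκ : |κ| ≤ r * s) (hσ : σ.IsSymm)
    (hb : ∀ i j, |σ i j| ≤ m ^ 2 / 3) (z w : V3) (hz : eNorm3 z ≤ r - 12 * m)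
    (hw : eNorm3 w ≤ s - 12 * m) : els z w (κ • (1 : Mat3) + σ) 0 ∈ lcHull (Kset r s) := by
  have n : ∀ a b c : ℝ, a ^ 2 + b ^ 2 + c ^ 2 ≤ 4 → eNorm3 ![a, b, c] ≤ 2 := fun a b c h => by
    refine Real.sqrt_le_iff.mpr ⟨by norm_num, ?_⟩
    simp only [Fin.sum_univ_three, Matrix.cons_val]
    linarith
  have b : ∀ i j, |σ i j| ≤ m ^ 2 := fun i j => (hb i j).trans (by nlinarith [sq_nonneg m])
  have b3 : ∀ i j k l, |σ i i - σ j k - σ l i| ≤ m ^ 2 := fun i j k l => by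
    have h1 := abs_le.mp (hb i i)
    have h2 := abs_le.mp (hb j k)
    have h3 := abs_le.mp (hb l i)
    exact abs_le.mpr ⟨by linarith, by linarith⟩
  have h0 := fun z w (hz : eNorm3 z ≤ r) (hw : eNorm3 w ≤ s) => els_scalar_mem hκ hz hw
  have h1 := els_rank_one_mem h0 (n 1 1 0 (by norm_num)) hm (b 0 1)
  have h2 := els_rank_one_mem h1 (n 1 0 1 (by norm_num)) hm (b 0 2)
  have h3 := els_rank_one_mem h2 (n 0 1 1 (by norm_num)) hm (b 1 2)
  have h4 := els_rank_one_mem h3 (n 1 0 0 (by norm_num)) hm (b3 0 0 1 2)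
  have h5 := els_rank_one_mem h4 (n 0 1 0 (by norm_num)) hm (b3 1 1 2 0)
  have h6 := els_rank_one_mem h5 (n 0 0 1 (by norm_num)) hm (b3 2 0 2 1)
  convert h6 z w (by linarith) (by linarith) using 2
  have s1 := hσ.apply 0 1
  have s2 := hσ.apply 0 2
  have s3 := hσ.apply 1 2
  ext i j
  fin_cases i <;> fin_cases j <;>
    simp [s1, s2, s3]
  ring

lemma els_mem_lcHull {r s m κ : ℝ} {σ : Mat3} {e z w : V3} (hm : 0 < m) (hκ : |κ| ≤ r * s)
    (hσ : σ.IsSymm) (hb : ∀ i j, |σ i j| ≤ m ^ 2 / 12) (he : eNorm3 e ≤ m ^ 2 / 12)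
    (hezw : dot3 e (z - w) = 0) (hz : eNorm3 z ≤ r - 13 * m) (hw : eNorm3 w ≤ s - 13 * m) :
    els z w (κ • (1 : Mat3) + σ) e ∈ lcHull (Kset r s) := by
  by_cases he0 : e = 0
  · subst he0
    exact els_symm_mem hm hκ hσ (fun i j => (hb i j).trans (by nlinarith [sq_nonneg m])) z w
      (by linarith) (by linarith)
  obtain ⟨f, hf, hfe⟩ := exists_unit_perp e
  have hzw : dot3 e z = dot3 e w := by
    rw [dot3_eq] at hezw
    simp only [dot3_eq]
    simp only [Pi.sub_apply] at hezw
    linear_combination hezw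
  set p : V3 := m • f with hpdef
  set q : V3 := (2 / m) • cross3 e f with hqdef
  have hp : eNorm3 p = m := by
    rw [hpdef, eNorm3_smul, eNorm3_eq, hf, Real.sqrt_one, mul_one, abs_of_pos hm]
  have hq : eNorm3 q = 2 / m * eNorm3 e := by
    rw [hqdef, eNorm3_smul, abs_of_pos (by positivity), eNorm3_eq, eNorm3_eq]
    congr 2
    simp only [dot3_eq, cross3_zero_apply, cross3_one_apply, cross3_two_apply] at hf hfe ⊢
    linear_combination (e 0 * e 0 + e 1 * e 1 + e 2 * e 2) * hf
      - (f 0 * e 0 + f 1 * e 1 + f 2 * e 2) * hfe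
  have hq' : eNorm3 q ≤ m / 6 := by
    rw [hq, div_mul_eq_mul_div, div_le_iff₀ hm]
    linarith
  have hpq : cross3 p q = (2 : ℝ) • e := by
    simp only [dot3_eq] at hf hfe
    rw [hpdef, hqdef]
    apply V3.ext3 <;> simp only [cross3_zero_apply, cross3_one_apply, cross3_two_apply,
      Pi.smul_apply, smul_eq_mul] <;> field_simp
    · linear_combination (e 0) * hf - (f 0) * hfe
    · linear_combination (e 1) * hf - (f 1) * hfe
    · linear_combination (e 2) * hf - (f 2) * hfe
  have hep : dot3 e p = 0 := by
    simp only [dot3_eq, hpdef, Pi.smul_apply, smul_eq_mul] at hfe ⊢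
    linear_combination m * hfe
  have heq : dot3 e q = 0 := by
    simp only [dot3_eq, hqdef, Pi.smul_apply, smul_eq_mul, cross3_zero_apply, cross3_one_apply,
      cross3_two_apply]
    ring
  set σ' : Mat3 := σ - (1 / 2 : ℝ) • (outer p q + outer q p) with hσ'
  have hs : σ'.IsSymm := by
    ext i j
    simp only [hσ', Matrix.transpose_apply, Matrix.sub_apply, Matrix.smul_apply,
      Matrix.add_apply, outer_apply, smul_eq_mul, hσ.apply]
    ring
  have hpq_le : ∀ i j, |p i * q j| ≤ m ^ 2 / 6 := fun i j => by
    have h1 := (abs_le_eNorm3 p i).trans hp.le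
    have h2 := (abs_le_eNorm3 q j).trans hq'
    rw [abs_mul]
    calc |p i| * |q j| ≤ m * (m / 6) := by gcongr
      _ = m ^ 2 / 6 := by ring
  have hb' : ∀ i j, |σ' i j| ≤ m ^ 2 / 3 := fun i j => by
    have h1 := abs_le.mp (hb i j)
    have h2 := abs_le.mp (hpq_le i j)
    have h3 := abs_le.mp (hpq_le j i)
    have h4 := sq_nonneg m
    simp only [hσ', Matrix.sub_apply, Matrix.smul_apply, Matrix.add_apply, outer_apply,
      smul_eq_mul]
    exact abs_le.mpr ⟨by linarith, by linarith⟩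
  have hL := els_symm_mem hm hκ hs hb'
  have := els_add_mem (ξt := -dot3 e w) he0 hep heq (by simp) (by simp [hzw])
    (hL (z + p) (w + q) ((eNorm3_add_le _ _).trans (by linarith))
      ((eNorm3_add_le _ _).trans (by linarith)))
    (hL (z - p) (w - q) ((eNorm3_sub_le _ _).trans (by linarith))
      ((eNorm3_sub_le _ _).trans (by linarith)))
  convert this using 2
  · rw [hσ']
    module
  · rw [hpq]
    module

lemma Vset_mono (r s : ℝ) {c d : ℝ} (h : c ≤ d) : Vset r s c ⊆ Vset r s d := by
  rintro V ⟨h1, h2, q, h3, h4, h5, h6, h7⟩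
  exact ⟨h1, h2, q, by linarith, by linarith, by linarith, by linarith, by linarith⟩

lemma exists_Vset_subset {r s r' s' : ℝ} (hr : r' < r) (hs : s' < s) (hrs : r' * s' < r * s) :
    ∃ c : ℝ, 0 < c ∧ Vset r' s' c ⊆ lcHull (Kset r s) := by
  obtain ⟨m, hm, hm1, hm2, hm3, hm4⟩ : ∃ m : ℝ, 0 < m ∧ m ≤ 1 ∧ 14 * m ≤ r - r' ∧
      14 * m ≤ s - s' ∧ m ≤ r * s - r' * s' := by
    refine ⟨min (min 1 ((r - r') / 14)) (min ((s - s') / 14) (r * s - r' * s')), ?_, ?_, ?_, ?_, ?_⟩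
    · refine lt_min (lt_min one_pos ?_) (lt_min ?_ ?_) <;> linarith
    · exact (min_le_left _ _).trans (min_le_left _ _)
    · linarith [(min_le_left (min 1 ((r - r') / 14)) (min ((s - s') / 14) (r * s - r' * s'))).trans
        (min_le_right _ _)]
    · linarith [(min_le_right (min 1 ((r - r') / 14)) (min ((s - s') / 14) (r * s - r' * s'))).trans
        (min_le_left _ _)]
    · exact (min_le_right _ _).trans (min_le_right _ _)
  have hc : m ^ 2 / 12 ≤ m := by nlinarith
  refine ⟨m ^ 2 / 12, by positivity, ?_⟩
  rintro ⟨u, S, B, E⟩ ⟨h1, h2, κ, h3, h4, h5, h6, h7⟩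
  simp only at h1 h2 h3 h4 h5 h6 h7
  have key := els_mem_lcHull (r := r) (s := s) (κ := κ) (e := E - cross3 B u) (z := u + B)
    (w := u - B) (σ := S - (outer u u - outer B B) - κ • (1 : Mat3)) hm (by linarith) ?_
    (fun i j => (abs_le_frobNorm _ i j).trans h5.le) h7.le ?_ (by linarith) (by linarith)
  · convert key using 1
    refine Prod.ext ?_ (Prod.ext ?_ (Prod.ext ?_ ?_))
    · simp only [els]
      module
    · ext i j
      simp only [els, Matrix.add_apply, Matrix.sub_apply, Matrix.smul_apply, outer_apply,
        Pi.add_apply, Pi.sub_apply, smul_eq_mul]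
      ring
    · simp only [els]
      module
    · apply V3.ext3 <;> simp only [els, cross3_zero_apply, cross3_one_apply, cross3_two_apply,
        Pi.add_apply, Pi.sub_apply, Pi.smul_apply, smul_eq_mul] <;> ring
  · ext i j
    simp only [Matrix.transpose_apply, Matrix.sub_apply, Matrix.smul_apply, outer_apply,
      h1.apply, Matrix.one_apply, eq_comm (a := j)]
    ring
  · simp only [dot3_eq, Pi.add_apply, Pi.sub_apply, cross3_zero_apply, cross3_one_apply,
      cross3_two_apply] at h2 ⊢
    linear_combination 2 * h2

lemma exists_thickening_subset_Vset {r s c : ℝ} (hc : 0 < c) :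
    ∃ ε : ℝ, 0 < ε ∧
      {V | V ∈ MSet ∧ ∃ W ∈ Kset r s, stateNorm (V - W) < ε} ⊆ Vset r s c := by
  set R : ℝ := |r| + |s| with hR
  have hR0 : 0 ≤ R := by positivity
  obtain ⟨ε, hε, hε1, hε2⟩ : ∃ ε : ℝ, 0 < ε ∧ ε ≤ 1 ∧ 4 * ((3 + 4 * R) * ε) ≤ c := by
    refine ⟨min 1 (c / (4 * (3 + 4 * R))), lt_min one_pos (by positivity), min_le_left _ _, ?_⟩
    have := min_le_right 1 (c / (4 * (3 + 4 * R)))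
    rw [le_div_iff₀ (by positivity)] at this
    linarith
  have hRε : 0 ≤ R * ε := by positivity
  refine ⟨ε, hε, ?_⟩
  rintro ⟨u, S, B, E⟩ ⟨⟨hS, hBE⟩, ⟨u', S', B', E'⟩, ⟨κ, hκ, hS', hE', hr, hs⟩, hd⟩
  simp only at hS hBE hS' hE' hr hs
  have du : ∀ i, |u i - u' i| ≤ ε := fun i => (abs_u_le_stateNorm _ i).trans hd.le
  have dB : ∀ i, |B i - B' i| ≤ ε := fun i => (abs_B_le_stateNorm _ i).trans hd.le
  have dS : ∀ i j, |S i j - S' i j| ≤ ε := fun i j => (abs_S_le_stateNorm _ i j).trans hd.le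
  have dE : ∀ i, |E i - E' i| ≤ ε := fun i => (abs_E_le_stateNorm _ i).trans hd.le
  have hz : ∀ i, |u' i + B' i| ≤ |r| := fun i =>
    (abs_le_eNorm3 (u' + B') i).trans (hr.le.trans (le_abs_self r))
  have hw : ∀ i, |u' i - B' i| ≤ |s| := fun i =>
    (abs_le_eNorm3 (u' - B') i).trans (hs.le.trans (le_abs_self s))
  have bu : ∀ i, |u' i| ≤ R := fun i => by
    have h1 := abs_le.mp (hz i)
    have h2 := abs_le.mp (hw i)
    exact abs_le.mpr ⟨by linarith, by linarith⟩
  have bB : ∀ i, |B' i| ≤ R := fun i => by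
    have h1 := abs_le.mp (hz i)
    have h2 := abs_le.mp (hw i)
    exact abs_le.mpr ⟨by linarith, by linarith⟩
  have prod : ∀ x y x' y' : ℝ, |x - x'| ≤ ε → |y - y'| ≤ ε → |x'| ≤ R → |y'| ≤ R →
      |x * y - x' * y'| ≤ (2 * R + 1) * ε := by
    intro x y x' y' hx hy hx' hy'
    have e : x * y - x' * y' = (x - x') * (y - y') + (x - x') * y' + x' * (y - y') := by ring
    have h1 : |(x - x') * (y - y')| ≤ 1 * ε := by rw [abs_mul]; gcongr; linarith
    have h2 : |(x - x') * y'| ≤ ε * R := by rw [abs_mul]; gcongr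
    have h3 : |x' * (y - y')| ≤ R * ε := by rw [abs_mul]; gcongr
    rw [e]
    refine (abs_add_three _ _ _).trans ?_
    linarith
  refine ⟨hS, hBE, κ, ?_, ?_, ?_, by linarith [le_abs_self (r * s)], ?_⟩
  · have e : u + B = (u' + B') + ((u + B) - (u' + B')) := by abel
    have h := eNorm3_le_two_mul (a := (u + B) - (u' + B')) (d := 2 * ε) fun i => by
      have h1 := abs_le.mp (du i)
      have h2 := abs_le.mp (dB i)
      simp only [Pi.add_apply, Pi.sub_apply]
      exact abs_le.mpr ⟨by linarith, by linarith⟩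
    have := eNorm3_add_le (u' + B') ((u + B) - (u' + B'))
    rw [← e] at this
    simp only
    linarith
  · have e : u - B = (u' - B') + ((u - B) - (u' - B')) := by abel
    have h := eNorm3_le_two_mul (a := (u - B) - (u' - B')) (d := 2 * ε) fun i => by
      have h1 := abs_le.mp (du i)
      have h2 := abs_le.mp (dB i)
      simp only [Pi.sub_apply]
      exact abs_le.mpr ⟨by linarith, by linarith⟩
    have := eNorm3_add_le (u' - B') ((u - B) - (u' - B'))
    rw [← e] at this
    simp only
    linarith
  · refine (frobNorm_le_three_mul (d := (3 + 4 * R) * ε) fun i j => ?_).trans_lt (by linarith)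
    have e := congrFun (congrFun hS' i) j
    simp only [Matrix.add_apply, Matrix.sub_apply, outer_apply] at e ⊢
    have h1 := abs_le.mp (dS i j)
    have h2 := abs_le.mp (prod _ _ _ _ (du i) (du j) (bu i) (bu j))
    have h3 := abs_le.mp (prod _ _ _ _ (dB i) (dB j) (bB i) (bB j))
    exact abs_le.mpr ⟨by linarith, by linarith⟩
  · refine (eNorm3_le_two_mul (d := (3 + 4 * R) * ε) fun i => ?_).trans_lt (by linarith)
    have key : ∀ j k, |(B j * u k - B k * u j) - (B' j * u' k - B' k * u' j)|
        ≤ (2 + 4 * R) * ε := fun j k => by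
      have h2 := abs_le.mp (prod _ _ _ _ (dB j) (du k) (bB j) (bu k))
      have h3 := abs_le.mp (prod _ _ _ _ (dB k) (du j) (bB k) (bu j))
      exact abs_le.mpr ⟨by linarith, by linarith⟩
    have hcr : |cross3 B u i - cross3 B' u' i| ≤ (2 + 4 * R) * ε := by
      fin_cases i
      · exact key 1 2
      · exact key 2 0
      · exact key 0 1
    have h1 := abs_le.mp (dE i)
    have h2 := abs_le.mp hcr
    rw [hE'] at h1
    simp only [Pi.sub_apply]
    exact abs_le.mpr ⟨by linarith, by linarith⟩

lemma Kset_subset_MSet (r s : ℝ) : Kset r s ⊆ MSet := by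
  rintro ⟨u, S, B, E⟩ ⟨κ, -, hS, hE, -, -⟩
  simp only at hS hE
  subst hS hE
  refine ⟨?_, ?_⟩
  · ext i j
    simp only [Matrix.transpose_apply, Matrix.add_apply, Matrix.sub_apply, Matrix.smul_apply,
      outer_apply, Matrix.one_apply, eq_comm (a := j)]
    ring
  · simp only [dot3_eq, cross3_zero_apply, cross3_one_apply, cross3_two_apply]
    ring

lemma Vset_subset_MSet (r s c : ℝ) : Vset r s c ⊆ MSet := fun _ h => ⟨h.1, h.2.1⟩

lemma Vset_mem_nhdsWithin {r s c : ℝ} {V : MHDState} (h : V ∈ Vset r s c) :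
    Vset r s c ∈ 𝓝[MSet] V := by
  obtain ⟨-, -, κ, h1, h2, h3, h4, h5⟩ := h
  have cn : Continuous eNorm3 := by unfold eNorm3; fun_prop
  have cf : Continuous frobNorm := by unfold frobNorm; fun_prop
  have c1 : Continuous fun V : MHDState => eNorm3 (V.1 + V.2.2.1) := cn.comp (by fun_prop)
  have c2 : Continuous fun V : MHDState => eNorm3 (V.1 - V.2.2.1) := cn.comp (by fun_prop)
  have c3 : Continuous fun V : MHDState => frobNorm
      (V.2.1 - (outer V.1 V.1 - outer V.2.2.1 V.2.2.1) - κ • (1 : Mat3)) :=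
    cf.comp (by fun_prop)
  have c5 : Continuous fun V : MHDState => eNorm3 (V.2.2.2 - cross3 V.2.2.1 V.1) :=
    cn.comp (by fun_prop)
  filter_upwards [self_mem_nhdsWithin,
    nhdsWithin_le_nhds (c1.continuousAt.eventually_lt continuousAt_const h1),
    nhdsWithin_le_nhds (c2.continuousAt.eventually_lt continuousAt_const h2),
    nhdsWithin_le_nhds (c3.continuousAt.eventually_lt continuousAt_const h3),
    nhdsWithin_le_nhds (c5.continuousAt.eventually_lt continuousAt_const h5)]
    with W hW w1 w2 w3 w5
  exact ⟨hW.1, hW.2, κ, w1, w2, w3, h4, w5⟩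

lemma thickening_mem_nhdsWithin {K : Set MHDState} {ε : ℝ} {V : MHDState}
    (h : V ∈ {V | V ∈ MSet ∧ ∃ W ∈ K, stateNorm (V - W) < ε}) :
    {V | V ∈ MSet ∧ ∃ W ∈ K, stateNorm (V - W) < ε} ∈ 𝓝[MSet] V := by
  obtain ⟨-, W, hW, hlt⟩ := h
  have c : Continuous fun V : MHDState => stateNorm (V - W) :=
    continuous_stateNorm.comp (by fun_prop)
  filter_upwards [self_mem_nhdsWithin,
    nhdsWithin_le_nhds (c.continuousAt.eventually_lt continuousAt_const hlt)] with V' h1 h2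
  exact ⟨h1, W, hW, h2⟩

lemma Kset_subset_thickening {r s ε : ℝ} (hε : 0 < ε) :
    Kset r s ⊆ {V | V ∈ MSet ∧ ∃ W ∈ Kset r s, stateNorm (V - W) < ε} := fun V hV =>
  ⟨Kset_subset_MSet r s hV, V, hV, by rwa [sub_self, stateNorm_zero]⟩

lemma Kset_subset_Vset {r s c : ℝ} (hc : 0 < c) : Kset r s ⊆ Vset r s c := by
  obtain ⟨ε, hε, h⟩ := exists_thickening_subset_Vset (r := r) (s := s) hc
  exact (Kset_subset_thickening hε).trans h

lemma exists_eps {r s : ℝ} (hr : 0 < r) (hs : 0 < s) {τ : ℝ} (hτ : τ ∈ Set.Ioo (0 : ℝ) 1) :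
    ∃ ε : ℝ, 0 < ε ∧ Vset (τ * r) (τ * s) ε ⊆ lcHull (Kset r s) ∧
      {V | V ∈ MSet ∧ ∃ W ∈ Kset (τ * r) (τ * s), stateNorm (V - W) < ε} ⊆ lcHull (Kset r s) := by
  have h1 : τ * r < r := by nlinarith [hτ.2]
  have h2 : τ * s < s := by nlinarith [hτ.2]
  obtain ⟨c, hc, hV⟩ := exists_Vset_subset h1 h2
    (mul_lt_mul'' h1 h2 (mul_pos hτ.1 hr).le (mul_pos hτ.1 hs).le)
  obtain ⟨ε, hε, hN⟩ := exists_thickening_subset_Vset (r := τ * r) (s := τ * s) hc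
  refine ⟨min c ε, lt_min hc hε, (Vset_mono _ _ (min_le_left _ _)).trans hV, ?_⟩
  rintro V ⟨hVM, W, hW, hlt⟩
  exact hV (hN ⟨hVM, W, hW, hlt.trans_le (min_le_right _ _)⟩)

/-- There exist constants ε_τ > 0, τ ∈ (0,1), such that for every τ₀ ∈ (0,1):
𝒰_{r,s} = ⋃_{τ₀<τ<1} (𝒱_{τr,τs,ε_τ})^{lc,Λ_g}
        = ⋃_{τ₀<τ<1} ({V ∈ ℳ : dist(V, K_{τr,τs}) < ε_τ})^{lc,Λ_g}
        = ⋃_{τ₀<τ<1} K_{τr,τs}^{lc,Λ}. -/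
theorem stmt16 (r s : ℝ) (hr : 0 < r) (hs : 0 < s) :
    ∃ ε : ℝ → ℝ, (∀ τ ∈ Set.Ioo (0 : ℝ) 1, 0 < ε τ) ∧
      ∀ τ₀ ∈ Set.Ioo (0 : ℝ) 1,
        (Uset r s = ⋃ τ ∈ Set.Ioo τ₀ 1, lcHullG (Vset (τ * r) (τ * s) (ε τ))) ∧
        (Uset r s = ⋃ τ ∈ Set.Ioo τ₀ 1, lcHullG
          {V | V ∈ MSet ∧ ∃ W ∈ Kset (τ * r) (τ * s), stateNorm (V - W) < ε τ}) ∧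
        (Uset r s = ⋃ τ ∈ Set.Ioo τ₀ 1, lcHull (Kset (τ * r) (τ * s))) := by
  choose ε hε hV hN using fun (τ : ℝ) (hτ : τ ∈ Set.Ioo (0 : ℝ) 1) => exists_eps hr hs hτ
  classical
  refine ⟨fun τ => if hτ : τ ∈ Set.Ioo (0 : ℝ) 1 then ε τ hτ else 1, ?_, ?_⟩
  · intro τ hτ
    simp only [dif_pos hτ, hε]
  intro τ₀ hτ₀
  have hmem : ∀ τ ∈ Set.Ioo τ₀ 1, τ ∈ Set.Ioo (0 : ℝ) 1 := fun τ hτ => ⟨hτ₀.1.trans hτ.1, hτ.2⟩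
  have hU := Uset_subset_iUnion r s hτ₀
  refine ⟨?_, ?_, ?_⟩
  · refine (hU.trans (Set.iUnion₂_mono fun τ hτ => ?_)).antisymm (Set.iUnion₂_subset fun τ hτ => ?_)
    all_goals simp only [dif_pos (hmem τ hτ)]
    · exact lcHull_subset_lcHullG (Vset_subset_MSet _ _ _) (fun _ => Vset_mem_nhdsWithin)
        (Kset_subset_Vset (hε τ (hmem τ hτ)))
    · exact lcHullG_subset_Uset (Vset_subset_MSet _ _ _) (fun _ => Vset_mem_nhdsWithin)
        (hV τ (hmem τ hτ))
  · refine (hU.trans (Set.iUnion₂_mono fun τ hτ => ?_)).antisymm (Set.iUnion₂_subset fun τ hτ => ?_)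
    all_goals simp only [dif_pos (hmem τ hτ)]
    · exact lcHull_subset_lcHullG (fun _ h => h.1) (fun _ => thickening_mem_nhdsWithin)
        (Kset_subset_thickening (hε τ (hmem τ hτ)))
    · exact lcHullG_subset_Uset (fun _ h => h.1) (fun _ => thickening_mem_nhdsWithin)
        (hN τ (hmem τ hτ))
  · refine hU.antisymm (Set.iUnion₂_subset fun τ hτ => ?_)
    exact (lcHull_subset_lcHullG (Vset_subset_MSet _ _ _) (fun _ => Vset_mem_nhdsWithin)
      (Kset_subset_Vset (hε τ (hmem τ hτ)))).trans
      (lcHullG_subset_Uset (Vset_subset_MSet _ _ _) (fun _ => Vset_mem_nhdsWithin)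
        (hV τ (hmem τ hτ)))
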